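/- arXiv:2511.01637 — 4 statements merged into one kernel-verified Lean document; each statement's English description precedes it below -/
import Mathlib

section
/- Let f : ℂ → ℂ be a transcendental entire function and let k, n be positive integers with n ≥ k + 1. If f^n and (f^n)^{(k)} share the value 1 IM, then f^n = (f^n)^{(k)} identically; that is, f(z) = c·e^{(λ/n)z} for some c, λ ∈ ℂ \ {0} with λ^k = 1. (Majumder et al.; the paper's Theorem 2.G.) -/
/-- A Grönwall estimate: if `‖f'‖ ≤ L (1 + ‖f‖)` on a disc, then `1 + ‖f‖` grows at most
exponentially on that disc. -/
theorem one_add_norm_le_mul_exp {f : ℂ → ℂ} (hf : Differentiable ℂ f) {L r : ℝ} (hL : 0 < L) {w : ℂ}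
    (h : ∀ z, ‖z - w‖ ≤ r → ‖deriv f z‖ ≤ L * (1 + ‖f z‖)) {z : ℂ} (hz : ‖z - w‖ ≤ r) :
    1 + ‖f z‖ ≤ (1 + ‖f w‖) * Real.exp (L * ‖z - w‖) := by
  rcases eq_or_ne z w with rfl | hne
  · simp
  have hpos : 0 < ‖z - w‖ := norm_pos_iff.2 (sub_ne_zero.2 hne)
  have hK : L * ‖z - w‖ ≠ 0 := (mul_pos hL hpos).ne'
  have hder : ∀ t : ℝ, HasDerivAt (fun t : ℝ => f (w + t * (z - w)))
      (deriv f (w + t * (z - w)) * (z - w)) t := by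
    intro t
    have h1 : HasDerivAt (fun t : ℂ => w + t * (z - w)) (z - w) (t : ℂ) := by
      simpa using ((hasDerivAt_id (t : ℂ)).mul_const (z - w)).const_add w
    exact ((hf _).hasDerivAt.comp (t : ℂ) h1).comp_ofReal
  have key := norm_le_gronwallBound_of_norm_deriv_right_le
    (f := fun t : ℝ => f (w + t * (z - w))) (f' := fun t : ℝ => deriv f (w + t * (z - w)) * (z - w))
    (δ := ‖f w‖) (K := L * ‖z - w‖) (ε := L * ‖z - w‖) (a := 0) (b := 1)
    (fun t _ => (hder t).continuousAt.continuousWithinAt)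
    (fun t _ => (hder t).hasDerivWithinAt) (by simp) ?_ 1 (by simp)
  · rw [gronwallBound_of_K_ne_0 hK, div_self hK] at key
    simp only [Complex.ofReal_one, one_mul, add_sub_cancel, sub_zero, mul_one] at key
    linarith
  · intro t ht
    have ht' : ‖(w + t * (z - w)) - w‖ ≤ r := by
      rw [add_sub_cancel_left, norm_mul, Complex.norm_real, Real.norm_of_nonneg ht.1]
      nlinarith [ht.2]
    have := h _ ht'
    rw [norm_mul]
    nlinarith

/-- A zero-free holomorphic function on a disc has a holomorphic logarithm there. -/
theorem exists_log_on_ball {f : ℂ → ℂ} {w : ℂ} {d : ℝ} (hf : DifferentiableOn ℂ f (Metric.ball w d))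
    (h0 : ∀ z ∈ Metric.ball w d, f z ≠ 0) :
    ∃ h : ℂ → ℂ, DifferentiableOn ℂ h (Metric.ball w d) ∧
      ∀ z ∈ Metric.ball w d, f z = Complex.exp (h z) := by
  rcases le_or_gt d 0 with hd | hd
  · exact ⟨0, by simp [Metric.ball_eq_empty.2 hd], by simp [Metric.ball_eq_empty.2 hd]⟩
  have hw : w ∈ Metric.ball w d := Metric.mem_ball_self hd
  obtain ⟨g, hg⟩ := ((hf.deriv Metric.isOpen_ball).div hf h0).isExactOn_ball
  have hconst : ∀ z ∈ Metric.ball w d, HasDerivAt (fun z => f z * Complex.exp (-g z)) 0 z := by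
    intro z hz
    have h1 := (hf.differentiableAt (Metric.isOpen_ball.mem_nhds hz)).hasDerivAt
    refine (h1.mul (hg z hz).neg.cexp).congr_deriv ?_
    have := h0 z hz
    simp only [Pi.div_apply, Pi.neg_apply]
    field_simp
    ring
  have heq : ∀ z ∈ Metric.ball w d,
      f z * Complex.exp (-g z) = f w * Complex.exp (-g w) := by
    intro z hz
    refine (convex_ball w d).is_const_of_fderivWithin_eq_zero (𝕜 := ℂ)
      (fun x hx => (hconst x hx).differentiableAt.differentiableWithinAt) ?_ hz hw
    intro x hx
    rw [fderivWithin_of_isOpen Metric.isOpen_ball hx]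
    have := (hconst x hx).hasFDerivAt.fderiv
    rw [this]
    ext; simp
  refine ⟨fun z => g z + (Complex.log (f w) - g w), ?_, ?_⟩
  · intro z hz
    exact ((hg z hz).differentiableAt.add_const _).differentiableWithinAt
  · intro z hz
    have := heq z hz
    rw [Complex.exp_neg, ← div_eq_mul_inv, div_eq_iff (Complex.exp_ne_zero _)] at this
    rw [this, Complex.exp_add, Complex.exp_sub, Complex.exp_log (h0 w hw), Complex.exp_neg]
    field_simp

theorem mapsTo_cayley {h : ℂ → ℂ} {w : ℂ} {d : ℝ} (hpos : ∀ z ∈ Metric.ball w d, 0 < (h z).re)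
    (hw : w ∈ Metric.ball w d) :
    Set.MapsTo (fun z => (h z - h w) / (h z + (starRingEnd ℂ) (h w))) (Metric.ball w d)
      (Metric.closedBall ((h w - h w) / (h w + (starRingEnd ℂ) (h w))) 1) := by
  intro z hz
  have h1 := hpos z hz
  have h2 := hpos w hw
  simp only [sub_self, zero_div, mem_closedBall_zero_iff]
  rw [norm_div]
  refine div_le_one_of_le₀ ?_ (norm_nonneg _)
  refine le_of_sq_le_sq ?_ (norm_nonneg _)
  rw [← Complex.normSq_eq_norm_sq, ← Complex.normSq_eq_norm_sq, Complex.normSq_apply,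
    Complex.normSq_apply]
  simp
  nlinarith

theorem cayley_den_ne_zero {h : ℂ → ℂ} {w : ℂ} {d : ℝ} (hpos : ∀ z ∈ Metric.ball w d, 0 < (h z).re)
    (hw : w ∈ Metric.ball w d) : ∀ z ∈ Metric.ball w d, h z + (starRingEnd ℂ) (h w) ≠ 0 := by
  intro z hz h0
  have h1 := hpos z hz
  have h2 := hpos w hw
  have := congrArg Complex.re h0
  simp at this
  linarith

theorem differentiableOn_cayley {h : ℂ → ℂ} {w : ℂ} {d : ℝ}
    (hh : DifferentiableOn ℂ h (Metric.ball w d)) (hpos : ∀ z ∈ Metric.ball w d, 0 < (h z).re)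
    (hw : w ∈ Metric.ball w d) :
    DifferentiableOn ℂ (fun z => (h z - h w) / (h z + (starRingEnd ℂ) (h w))) (Metric.ball w d) :=
  (hh.sub_const _).div (hh.add_const _) (cayley_den_ne_zero hpos hw)

/-- Schwarz lemma for maps into the right half-plane: gradient estimate at the centre. -/
theorem norm_deriv_le_of_re_pos {h : ℂ → ℂ} {w : ℂ} {d : ℝ} (hd : 0 < d)
    (hh : DifferentiableOn ℂ h (Metric.ball w d)) (hpos : ∀ z ∈ Metric.ball w d, 0 < (h z).re) :
    ‖deriv h w‖ * d ≤ 2 * (h w).re := by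
  have hw : w ∈ Metric.ball w d := Metric.mem_ball_self hd
  have key := Complex.norm_deriv_le_div_of_mapsTo_ball
    (differentiableOn_cayley hh hpos hw) (mapsTo_cayley hpos hw) hd
  have h1 := (hh.differentiableAt (Metric.isOpen_ball.mem_nhds hw)).hasDerivAt
  have h2 := (h1.sub_const (h w)).div (h1.add_const ((starRingEnd ℂ) (h w)))
    (cayley_den_ne_zero hpos hw w hw)
  have h3 : h w + (starRingEnd ℂ) (h w) = ((2 * (h w).re : ℝ) : ℂ) := by
    rw [Complex.add_conj]
  have h4 := hpos w hw
  have h5 := cayley_den_ne_zero hpos hw w hw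
  have h6 : deriv (fun z => (h z - h w) / (h z + (starRingEnd ℂ) (h w))) w
      = deriv h w / (h w + (starRingEnd ℂ) (h w)) := by
    refine h2.deriv.trans ?_
    field_simp
    ring
  rw [h6, h3, norm_div, Complex.norm_real, Real.norm_of_nonneg (by linarith),
    div_le_div_iff₀ (by linarith) hd] at key
  linarith

/-- Harnack inequality for the real part of a holomorphic function. -/
theorem harnack_re {h : ℂ → ℂ} {w : ℂ} {d : ℝ}
    (hh : DifferentiableOn ℂ h (Metric.ball w d)) (hpos : ∀ z ∈ Metric.ball w d, 0 < (h z).re)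
    {z : ℂ} (hz : z ∈ Metric.ball w d) :
    (h w).re * (d - dist z w) ≤ (h z).re * (d + dist z w) := by
  have hd : 0 < d := dist_nonneg.trans_lt hz
  have hw : w ∈ Metric.ball w d := Metric.mem_ball_self hd
  have key := Complex.dist_le_div_mul_dist_of_mapsTo_ball
    (differentiableOn_cayley hh hpos hw) (mapsTo_cayley hpos hw) hz
  simp only [sub_self, zero_div, dist_zero_right, norm_div] at key
  have hden : 0 < ‖h z + (starRingEnd ℂ) (h w)‖ := norm_pos_iff.2 (cayley_den_ne_zero hpos hw z hz)
  rw [div_le_iff₀ hden] at key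
  have hzd : dist z w < d := hz
  have ht0 : 0 ≤ dist z w := dist_nonneg
  have key2 : d * ‖h z - h w‖ ≤ dist z w * ‖h z + (starRingEnd ℂ) (h w)‖ := by
    calc d * ‖h z - h w‖ ≤ d * (1 / d * dist z w * ‖h z + (starRingEnd ℂ) (h w)‖) := by gcongr
      _ = _ := by field_simp
  have key3 := pow_le_pow_left₀ (by positivity) key2 2
  rw [mul_pow, mul_pow, ← Complex.normSq_eq_norm_sq, ← Complex.normSq_eq_norm_sq,
    Complex.normSq_apply, Complex.normSq_apply] at key3
  simp only [Complex.sub_re, Complex.sub_im, Complex.add_re, Complex.add_im, Complex.conj_re,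
    Complex.conj_im] at key3
  have h1 := hpos z hz
  have h2 := hpos w hw
  set a := (h w).re
  set x := (h z).re
  set y := (h z).im + -(h w).im
  set t := dist z w
  have h4 : (d * (x - a)) ^ 2 ≤ (t * (x + a)) ^ 2 := by
    have : (h z).im - (h w).im = y := by ring
    rw [this] at key3
    have h7 : t ^ 2 * (y * y) ≤ d ^ 2 * (y * y) :=
      mul_le_mul_of_nonneg_right (pow_le_pow_left₀ ht0 hzd.le 2) (mul_self_nonneg y)
    nlinarith
  have h5 := abs_le_of_sq_le_sq' h4 (by positivity)
  linarith [h5.1]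

/-- Boundary estimate of Hopf type for an entire function larger than one on a disc and touching
modulus one on its boundary. -/
theorem norm_deriv_le_of_one_lt_norm {f : ℂ → ℂ} (hf : Differentiable ℂ f) {w z₁ : ℂ} {d M : ℝ}
    (hd : 0 < d) (hlt : ∀ z ∈ Metric.ball w d, 1 < ‖f z‖) (hz₁ : ‖z₁ - w‖ = d) (h1 : ‖f z₁‖ ≤ 1)
    (hM : ‖deriv f z₁‖ ≤ M) : ‖deriv f w‖ ≤ 4 * M * ‖f w‖ := by
  have hw : w ∈ Metric.ball w d := Metric.mem_ball_self hd
  obtain ⟨h, hh, hfh⟩ := exists_log_on_ball (w := w) (d := d) hf.differentiableOn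
    (fun z hz => norm_pos_iff.1 (one_pos.trans (hlt z hz)))
  have hre : ∀ z ∈ Metric.ball w d, Real.exp (h z).re = ‖f z‖ := by
    intro z hz
    rw [hfh z hz, Complex.norm_exp]
  have hpos : ∀ z ∈ Metric.ball w d, 0 < (h z).re := by
    intro z hz
    rw [← Real.one_lt_exp_iff, hre z hz]
    exact hlt z hz
  have hder : deriv f w = f w * deriv h w := by
    have e1 : f =ᶠ[nhds w] fun z => Complex.exp (h z) :=
      Filter.eventuallyEq_of_mem (Metric.isOpen_ball.mem_nhds hw) hfh
    rw [e1.deriv_eq, (hh.differentiableAt (Metric.isOpen_ball.mem_nhds hw)).hasDerivAt.cexp.deriv,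
      ← hfh w hw]
  have hA : (h w).re ≤ 2 * (M * d) := by
    have hcurve : HasDerivAt (fun s : ℝ => f (z₁ + s * (w - z₁))) (deriv f z₁ * (w - z₁)) 0 := by
      have h1 : HasDerivAt (fun t : ℂ => z₁ + t * (w - z₁)) (w - z₁) ((0 : ℝ) : ℂ) := by
        simpa using ((hasDerivAt_id ((0 : ℝ) : ℂ)).mul_const (w - z₁)).const_add z₁
      have h2 : HasDerivAt f (deriv f z₁) (z₁ + ((0 : ℝ) : ℂ) * (w - z₁)) := by
        simpa using (hf z₁).hasDerivAt
      exact (h2.comp ((0 : ℝ) : ℂ) h1).comp_ofReal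
    have hlim : Filter.Tendsto (fun s : ℝ => ‖s⁻¹ • (f (z₁ + s * (w - z₁)) - f z₁)‖)
        (nhdsWithin 0 (Set.Ioi 0)) (nhds ‖deriv f z₁ * (w - z₁)‖) := by
      have := (hasDerivAt_iff_tendsto_slope.1 hcurve).norm
      refine (this.mono_left (nhdsWithin_mono _ (fun x hx => ne_of_gt hx))).congr ?_
      intro s
      simp [slope]
    have hge : (h w).re / 2 ≤ ‖deriv f z₁ * (w - z₁)‖ := by
      refine ge_of_tendsto hlim ?_
      filter_upwards [Ioo_mem_nhdsGT (zero_lt_one' ℝ)] with s hs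
      have hdist : dist (z₁ + s * (w - z₁)) w = (1 - s) * d := by
        rw [dist_eq_norm, show z₁ + s * (w - z₁) - w = ((1 - s : ℝ) : ℂ) * (z₁ - w) by
          push_cast; ring, norm_mul, Complex.norm_real, hz₁,
          Real.norm_of_nonneg (by linarith [hs.2])]
      have hmem : z₁ + s * (w - z₁) ∈ Metric.ball w d := by
        rw [Metric.mem_ball, hdist]
        nlinarith [hs.1]
      have hH := harnack_re hh hpos hmem
      rw [hdist] at hH
      have hp := hpos _ hmem
      have hlog : (h (z₁ + s * (w - z₁))).re ≤ ‖f (z₁ + s * (w - z₁)) - f z₁‖ := by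
        have e1 := Real.add_one_le_exp (h (z₁ + s * (w - z₁))).re
        rw [hre _ hmem] at e1
        have := norm_sub_norm_le (f (z₁ + s * (w - z₁))) (f z₁)
        linarith
      rw [norm_smul, norm_inv, Real.norm_of_nonneg hs.1.le, inv_mul_eq_div, le_div_iff₀ hs.1]
      refine le_trans ?_ hlog
      have : d * ((h w).re * s) ≤ d * (2 * (h (z₁ + s * (w - z₁))).re) := by
        nlinarith [mul_pos hp (mul_pos hs.1 hd)]
      have := le_of_mul_le_mul_left this hd
      linarith
    rw [norm_mul, norm_sub_rev, hz₁] at hge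
    nlinarith
  have hB := norm_deriv_le_of_re_pos hd hh hpos
  have hC : ‖deriv h w‖ ≤ 4 * M := by
    refine le_of_mul_le_mul_right ?_ hd
    linarith
  rw [hder, norm_mul, mul_comm]
  gcongr

/-- A zero-free entire function of exponential type is `exp` of an affine function. -/
theorem exists_eq_exp_affine {f : ℂ → ℂ} (hf : Differentiable ℂ f) (h0 : ∀ z, f z ≠ 0) {K L : ℝ}
    (hK : 0 < K) (hL : 0 ≤ L) (hb : ∀ z, ‖f z‖ ≤ K * Real.exp (L * ‖z‖)) :
    ∃ a b : ℂ, ∀ z, f z = Complex.exp (a * z + b) := by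
  have hq : Differentiable ℂ (fun z => deriv f z / f z) := hf.deriv.div hf h0
  obtain ⟨g, hg⟩ := hq.isExactOn_univ
  have hbound : ∀ w, ‖deriv f w / f w‖ ≤ 2 * L := by
    intro w
    have hlim : Filter.Tendsto (fun R : ℝ =>
        2 * (Real.log K - Real.log ‖f w‖ + 1 + L * ‖w‖) / R + 2 * L) Filter.atTop
        (nhds (0 + 2 * L)) :=
      (tendsto_const_nhds.div_atTop Filter.tendsto_id).add_const _
    rw [zero_add] at hlim
    refine ge_of_tendsto hlim ?_
    filter_upwards [Filter.eventually_gt_atTop 0] with R hR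
    obtain ⟨h, hh, hfh⟩ := exists_log_on_ball (w := w) (d := R) hf.differentiableOn
      (fun z _ => h0 z)
    have hw : w ∈ Metric.ball w R := Metric.mem_ball_self hR
    have hre : ∀ z ∈ Metric.ball w R, Real.log ‖f z‖ = (h z).re := by
      intro z hz
      rw [hfh z hz, Complex.norm_exp, Real.log_exp]
    have hpos : ∀ z ∈ Metric.ball w R,
        0 < (((Real.log K + 1 + L * (‖w‖ + R) : ℝ) : ℂ) - h z).re := by
      intro z hz
      have e1 := Real.log_le_log (norm_pos_iff.2 (h0 z)) (hb z)
      rw [Real.log_mul hK.ne' (Real.exp_pos _).ne', Real.log_exp, hre z hz] at e1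
      have e2 : ‖z‖ ≤ ‖w‖ + R := by
        have := norm_sub_norm_le z w
        have h3 : ‖z - w‖ < R := by simpa [dist_eq_norm] using hz
        linarith
      simp only [Complex.sub_re, Complex.ofReal_re]
      nlinarith
    have key := norm_deriv_le_of_re_pos hR (hh.const_sub _) hpos
    have hder : deriv f w = f w * deriv h w := by
      have e1 : f =ᶠ[nhds w] fun z => Complex.exp (h z) :=
        Filter.eventuallyEq_of_mem (Metric.isOpen_ball.mem_nhds hw) hfh
      rw [e1.deriv_eq,
        (hh.differentiableAt (Metric.isOpen_ball.mem_nhds hw)).hasDerivAt.cexp.deriv, ← hfh w hw]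
    rw [deriv_const_sub, norm_neg] at key
    rw [hder, mul_div_cancel_left₀ _ (h0 w), hre w hw]
    simp only [Complex.sub_re, Complex.ofReal_re] at key
    rw [← sub_le_iff_le_add, le_div_iff₀ hR]
    nlinarith
  have hconst := fun z => hq.apply_eq_apply_of_bounded
    (isBounded_iff_forall_norm_le.2 ⟨2 * L, by rintro _ ⟨w, rfl⟩; exact hbound w⟩) z 0
  set a := deriv f 0 / f 0 with ha
  have hconst' : ∀ z, f z * Complex.exp (-(a * z)) = f 0 := by
    have hd : ∀ z, HasDerivAt (fun z => f z * Complex.exp (-(a * z))) 0 z := by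
      intro z
      refine ((hf z).hasDerivAt.mul
        (((hasDerivAt_id z).const_mul a).neg.cexp)).congr_deriv ?_
      have h2 : deriv f z = a * f z := by rw [← hconst z, div_mul_cancel₀ _ (h0 z)]
      rw [h2]
      simp
      ring
    intro z
    have := is_const_of_deriv_eq_zero (fun z => (hd z).differentiableAt) (fun z => (hd z).deriv) z 0
    simpa using this
  refine ⟨a, Complex.log (f 0), fun z => ?_⟩
  rw [Complex.exp_add, Complex.exp_log (h0 0), ← hconst' z, Complex.exp_neg]
  field_simp

theorem iteratedDeriv_add' {f : ℂ → ℂ} (m i : ℕ) :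
    iteratedDeriv (m + i) f = iteratedDeriv i (iteratedDeriv m f) := by
  rw [iteratedDeriv_eq_iterate, iteratedDeriv_eq_iterate, iteratedDeriv_eq_iterate,
    ← Function.iterate_add_apply, add_comm]

/-- Uniqueness for the entire solutions of `u⁽ᵐ⁾ = a u`. -/
theorem eq_zero_of_iteratedDeriv_eq_mul {u : ℂ → ℂ} (hu : Differentiable ℂ u) {m : ℕ} {a : ℂ}
    (hm : 1 ≤ m) (h : ∀ z, iteratedDeriv m u z = a * u z) {z₀ : ℂ}
    (h0 : ∀ i < m, iteratedDeriv i u z₀ = 0) (z : ℂ) : u z = 0 := by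
  have hall : ∀ i, iteratedDeriv i u z₀ = 0 := by
    intro i
    induction i using Nat.strong_induction_on with
    | _ i ih =>
      rcases lt_or_ge i m with hi | hi
      · exact h0 i hi
      · obtain ⟨j, rfl⟩ := Nat.exists_eq_add_of_le hi
        rw [iteratedDeriv_add', show iteratedDeriv m u = fun z => a * u z from funext h,
          iteratedDeriv_const_mul_field, ih j (by omega), mul_zero]
  have := Complex.hasSum_taylorSeries_of_entire hu z₀ z
  simp only [hall, smul_zero] at this
  exact this.unique hasSum_zero

section

open Filter Topology Metric

/-- Montel's theorem along an ultrafilter: a locally uniformly bounded family of entire functions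
converges locally uniformly. -/
theorem exists_tendstoLocallyUniformlyOn_of_bounded {ι : Type*} (𝓤 : Ultrafilter ι)
    {F : ι → ℂ → ℂ} {U : Set ℂ} (hF : ∀ j, Differentiable ℂ (F j))
    (hb : ∀ x ∈ U, ∃ r > 0, ∃ C : ℝ, ∀ᶠ j in (𝓤 : Filter ι), ∀ z ∈ ball x r, ‖F j z‖ ≤ C) :
    ∃ g : ℂ → ℂ, TendstoLocallyUniformlyOn F g 𝓤 U := by
  have hlim : ∀ x ∈ U, ∃ y, Tendsto (fun j => F j x) 𝓤 (𝓝 y) := by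
    intro x hx
    obtain ⟨r, hr, C, hC⟩ := hb x hx
    have hle : ((𝓤.map fun j => F j x : Ultrafilter ℂ) : Filter ℂ) ≤ 𝓟 (closedBall 0 C) := by
      rw [le_principal_iff]
      show ∀ᶠ j in (𝓤 : Filter ι), F j x ∈ closedBall 0 C
      filter_upwards [hC] with j hj
      simpa using hj x (mem_ball_self hr)
    obtain ⟨y, _, hy⟩ := (isCompact_closedBall (0 : ℂ) C).ultrafilter_le_nhds _ hle
    exact ⟨y, hy⟩
  choose! g hg using hlim
  refine ⟨g, Metric.tendstoLocallyUniformlyOn_iff.2 fun ε hε x hx => ?_⟩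
  obtain ⟨r, hr, C, hC⟩ := hb x hx
  set K : ℝ := 2 * |C| / r with hK
  have hK0 : 0 ≤ K := by positivity
  have hlip : ∀ᶠ j in (𝓤 : Filter ι), ∀ y ∈ ball x r, dist (F j y) (F j x) ≤ K * dist y x := by
    filter_upwards [hC] with j hj y hy
    refine Complex.dist_le_div_mul_dist_of_mapsTo_ball (hF j).differentiableOn ?_ hy
    intro z hz
    rw [mem_closedBall, dist_eq_norm]
    have h1 := hj z hz
    have h2 := hj x (mem_ball_self hr)
    have h3 := norm_sub_le (F j z) (F j x)
    have h4 := le_abs_self C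
    linarith
  have hlipg : ∀ y ∈ ball x r, y ∈ U → dist (g y) (g x) ≤ K * dist y x := by
    intro y hy hyU
    refine le_of_tendsto ((hg y hyU).dist (hg x hx)) ?_
    filter_upwards [hlip] with j hj using hj y hy
  have hδ : 0 < ε / (4 * (K + 1)) := by positivity
  refine ⟨U ∩ ball x (min r (ε / (4 * (K + 1)))), ?_, ?_⟩
  · exact inter_mem self_mem_nhdsWithin (mem_nhdsWithin_of_mem_nhds
      (ball_mem_nhds x (lt_min hr hδ)))
  · have hnear := (Metric.tendsto_nhds.1 (hg x hx)) (ε / 4) (by positivity)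
    filter_upwards [hlip, hnear] with j hj hjx y hy
    have hyr : y ∈ ball x r := mem_ball.2 ((mem_ball.1 hy.2).trans_le (min_le_left _ _))
    have hyd : dist y x < ε / (4 * (K + 1)) := (mem_ball.1 hy.2).trans_le (min_le_right _ _)
    have h1 := hlipg y hyr hy.1
    have h2 := hj y hyr
    have h3 : K * dist y x ≤ ε / 4 := by
      rw [lt_div_iff₀ (by positivity)] at hyd
      nlinarith [dist_nonneg (x := y) (y := x)]
    have h4 := dist_triangle4 (g y) (g x) (F j x) (F j y)
    rw [dist_comm (F j x) (g x)] at hjx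
    rw [dist_comm (F j y) (F j x)] at h2
    linarith

/-- A function `ψ` holomorphic on the unit disc is controlled at the origin by a bound on `ψ * E`,
uniformly over the entire functions `E` that are bounded on a disc and not too small
somewhere on a smaller one. -/
theorem exists_bound_of_mul_bound {R ε B : ℝ} (hR : 0 ≤ R) (hε : 0 < ε) :
    ∃ K : ℝ, ∀ E : ℂ → ℂ, Differentiable ℂ E → (∀ z ∈ ball (0 : ℂ) (R + 1), ‖E z‖ ≤ B) →
      (∃ z, ‖z‖ ≤ R ∧ ε ≤ ‖E z‖) → ∀ ψ : ℂ → ℂ, DifferentiableOn ℂ ψ (ball 0 1) →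
      (∀ z ∈ ball (0 : ℂ) 1, ‖ψ z * E z‖ ≤ B) → ‖ψ 0‖ ≤ K := by
  by_contra! hcon
  choose E hE hEB hEε ψ hψ hψE hψ0 using fun j : ℕ => hcon j
  choose z hzR hzε using hEε
  set 𝓤 : Ultrafilter ℕ := hyperfilter ℕ
  have h𝓤 : (𝓤 : Filter ℕ) ≤ atTop := Nat.hyperfilter_le_atTop
  obtain ⟨g, hg⟩ := exists_tendstoLocallyUniformlyOn_of_bounded 𝓤 hE (U := ball (0 : ℂ) (R + 1))
    (by
      intro x hx
      obtain ⟨r, hr, hsub⟩ := Metric.isOpen_iff.1 isOpen_ball x hx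
      exact ⟨r, hr, B, Eventually.of_forall fun j z hz => hEB j z (hsub hz)⟩)
  have hgd : DifferentiableOn ℂ g (ball 0 (R + 1)) :=
    hg.differentiableOn (Eventually.of_forall fun j => (hE j).differentiableOn) isOpen_ball
  have hunif := (tendstoLocallyUniformlyOn_iff_forall_isCompact isOpen_ball).1 hg
  have hgne : ¬ ∀ᶠ z in 𝓝 (0 : ℂ), g z = 0 := by
    intro hev
    have hzero := (hgd.analyticOnNhd isOpen_ball).eqOn_zero_of_preconnected_of_eventuallyEq_zero
      (convex_ball _ _).isPreconnected (mem_ball_self (by linarith)) hev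
    have hsub : closedBall (0 : ℂ) R ⊆ ball 0 (R + 1) := closedBall_subset_ball (by linarith)
    have h1 := Metric.tendstoUniformlyOn_iff.1
      (hunif (closedBall 0 R) hsub (isCompact_closedBall _ _)) ε hε
    obtain ⟨j, hj⟩ := h1.exists
    have hzj : z j ∈ closedBall (0 : ℂ) R := by simpa using hzR j
    have h2 := hj (z j) hzj
    rw [hzero (hsub hzj)] at h2
    simp only [Pi.zero_apply, dist_zero_left] at h2
    exact absurd (hzε j) (not_le.2 h2)
  have han : AnalyticAt ℂ g 0 := hgd.analyticAt (ball_mem_nhds 0 (by linarith))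
  have hpunct := (han.eventually_eq_zero_or_eventually_ne_zero).resolve_left hgne
  rw [eventually_nhdsWithin_iff, Metric.eventually_nhds_iff] at hpunct
  obtain ⟨δ, hδ, hδg⟩ := hpunct
  obtain ⟨r, hr0, hrlt⟩ := exists_between (lt_min hδ one_pos)
  have hrδ : r < δ := hrlt.trans_le (min_le_left _ _)
  have hr1 : r < 1 := hrlt.trans_le (min_le_right _ _)
  have hsph : sphere (0 : ℂ) r ⊆ ball 0 (R + 1) :=
    sphere_subset_closedBall.trans (closedBall_subset_ball (by linarith))
  obtain ⟨x, hx, hmin⟩ := (isCompact_sphere (0 : ℂ) r).exists_isMinOn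
    (NormedSpace.sphere_nonempty.2 hr0.le) ((hgd.continuousOn.mono hsph).norm)
  have hm : 0 < ‖g x‖ := by
    refine norm_pos_iff.2 (hδg ?_ ?_)
    · rw [mem_sphere.1 hx]; exact hrδ
    · rintro rfl
      simp at hx
      exact hr0.ne hx
  have h1 := Metric.tendstoUniformlyOn_iff.1 (hunif _ hsph (isCompact_sphere _ _)) (‖g x‖ / 2)
    (half_pos hm)
  have h2 : ∀ᶠ j : ℕ in (𝓤 : Filter ℕ), B / (‖g x‖ / 2) < (j : ℝ) :=
    h𝓤 (tendsto_natCast_atTop_atTop.eventually_gt_atTop _)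
  obtain ⟨j, hj, hjbig⟩ := (h1.and h2).exists
  have hle : ‖ψ j 0‖ ≤ B / (‖g x‖ / 2) := by
    refine Complex.norm_le_of_forall_mem_frontier_norm_le (U := ball (0 : ℂ) r) isBounded_ball
      ((hψ j).diffContOnCl_ball (closedBall_subset_ball hr1)) ?_
      (subset_closure (mem_ball_self hr0))
    intro y hy
    rw [frontier_ball _ hr0.ne'] at hy
    have hyj := hj y hy
    have hgy : ‖g x‖ ≤ ‖g y‖ := hmin hy
    have hEy : ‖g x‖ / 2 ≤ ‖E j y‖ := by
      rw [dist_eq_norm] at hyj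
      have := norm_sub_norm_le (g y) (E j y)
      linarith
    have hy1 : y ∈ ball (0 : ℂ) 1 := by
      rw [mem_ball, mem_sphere.1 hy]; exact hr1
    have := hψE j y hy1
    rw [norm_mul] at this
    rw [le_div_iff₀ (half_pos hm)]
    exact (mul_le_mul_of_nonneg_left hEy (norm_nonneg _)).trans this
  have := hψ0 j
  linarith

/-- The version of `exists_bound_of_mul_bound` at an arbitrary centre. -/
theorem exists_bound_of_mul_bound_at {R ε B : ℝ} (hR : 0 ≤ R) (hε : 0 < ε) :
    ∃ K : ℝ, ∀ (w : ℂ) (E : ℂ → ℂ), Differentiable ℂ E →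
      (∀ z, ‖z - w‖ < R + 1 → ‖E z‖ ≤ B) →
      (∃ z, ‖z - w‖ ≤ R ∧ ε ≤ ‖E z‖) → ∀ ψ : ℂ → ℂ, DifferentiableOn ℂ ψ (ball w 1) →
      (∀ z ∈ ball w 1, ‖ψ z * E z‖ ≤ B) → ‖ψ w‖ ≤ K := by
  obtain ⟨K, hK⟩ := exists_bound_of_mul_bound (B := B) hR hε
  refine ⟨K, fun w E hE hEB ⟨z, hz, hzε⟩ ψ hψ hψE => ?_⟩
  have := hK (fun z => E (w + z)) (hE.comp (differentiable_id.const_add w))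
    (fun z hz => hEB _ (by simpa using hz)) ⟨z - w, hz, by simpa using hzε⟩ (fun z => ψ (w + z))
    (hψ.comp (differentiable_id.const_add w).differentiableOn
      (fun z hz => by simpa [dist_eq_norm] using hz))
    (fun z hz => hψE _ (by simpa [dist_eq_norm] using hz))
  simpa using this

/-- Hurwitz's theorem for entire functions: a locally uniform limit of functions that are
eventually zero-free near every point is zero-free or identically zero. -/
theorem hurwitz_entire {ι : Type*} {𝓤 : Filter ι} [𝓤.NeBot] {E : ι → ℂ → ℂ} {g : ℂ → ℂ}
    (hE : ∀ j, Differentiable ℂ (E j)) (hg : TendstoLocallyUniformlyOn E g 𝓤 Set.univ)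
    (h0 : ∀ r : ℝ, ∀ᶠ j in 𝓤, ∀ z ∈ ball (0 : ℂ) r, E j z ≠ 0) :
    (∀ z, g z ≠ 0) ∨ ∀ z, g z = 0 := by
  by_contra! hcon
  obtain ⟨⟨w, hw⟩, ⟨x, hx⟩⟩ := hcon
  have hgc : Continuous g := by
    have := hg.differentiableOn (Eventually.of_forall fun j => (hE j).differentiableOn) isOpen_univ
    exact (differentiableOn_univ.1 this).continuous
  have hunif := (tendstoLocallyUniformlyOn_iff_forall_isCompact isOpen_univ).1 hg
  obtain ⟨C, hC⟩ := (isCompact_closedBall w (‖x - w‖ + 1)).exists_bound_of_continuousOn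
    hgc.continuousOn
  obtain ⟨K, hK⟩ := exists_bound_of_mul_bound_at (B := C + 1) (norm_nonneg (x - w))
    (half_pos (norm_pos_iff.2 hx))
  have hδ : 0 < min (‖g x‖ / 2) 1 := lt_min (half_pos (norm_pos_iff.2 hx)) one_pos
  have h1 := Metric.tendstoUniformlyOn_iff.1
    (hunif (closedBall w (‖x - w‖ + 1)) (Set.subset_univ _) (isCompact_closedBall _ _)) _ hδ
  have hxm : x ∈ closedBall w (‖x - w‖ + 1) := by rw [mem_closedBall, dist_eq_norm]; linarith
  have hwm : w ∈ closedBall w (‖x - w‖ + 1) := mem_closedBall_self (by positivity)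
  have hC0 : 0 ≤ C := (norm_nonneg _).trans (hC w hwm)
  have hEw : ∀ᶠ j in 𝓤, 1 ≤ K * ‖E j w‖ := by
    filter_upwards [h1, h0 (‖w‖ + 1)] with j hj hj0
    have hne : ∀ z ∈ ball w 1, E j z ≠ 0 := by
      intro z hz
      refine hj0 z ?_
      rw [mem_ball, dist_eq_norm] at hz
      rw [mem_ball_zero_iff]
      have := norm_sub_norm_le z w
      linarith
    have := hK w (E j) (hE j) (fun z hz => by
        have hzm : z ∈ closedBall w (‖x - w‖ + 1) := by
          rw [mem_closedBall, dist_eq_norm]; exact hz.le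
        have h2 := (hj z hzm).trans_le (min_le_right _ _)
        rw [dist_comm, dist_eq_norm] at h2
        have h3 := norm_sub_norm_le (E j z) (g z)
        have h4 := hC z hzm
        linarith)
      ⟨x, le_rfl, by
        have h2 := (hj x hxm).trans_le (min_le_left _ _)
        rw [dist_eq_norm] at h2
        have h3 := norm_sub_norm_le (g x) (E j x)
        linarith⟩ (fun z => (E j z)⁻¹) ((hE j).differentiableOn.inv hne)
      (fun z hz => by rw [inv_mul_cancel₀ (hne z hz)]; simpa using hC0)
    have hpos : 0 < ‖E j w‖ := norm_pos_iff.2 (hne w (mem_ball_self one_pos))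
    rwa [norm_inv, inv_le_iff_one_le_mul₀ hpos] at this
  have hlim : Tendsto (fun j => K * ‖E j w‖) 𝓤 (𝓝 (K * ‖g w‖)) :=
    ((hg.tendsto_at (Set.mem_univ w)).norm).const_mul K
  have := ge_of_tendsto hlim hEw
  rw [hw] at this
  simp at this
  linarith

/-- Division of entire functions: if `N` vanishes at least to the order of `E` everywhere, then `N`
is an entire multiple of `E`. -/
theorem exists_eq_mul_of_analyticOrderAt_le {N E : ℂ → ℂ} (hN : Differentiable ℂ N)
    (hE : Differentiable ℂ E) {x₀ : ℂ} (hx₀ : E x₀ ≠ 0)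
    (h : ∀ z, E z = 0 → analyticOrderAt E z ≤ analyticOrderAt N z) :
    ∃ φ : ℂ → ℂ, Differentiable ℂ φ ∧ ∀ z, N z = φ z * E z := by
  have hEan : AnalyticOnNhd ℂ E Set.univ := fun z _ => hE.analyticAt z
  have hloc : ∀ z, ∃ q : ℂ → ℂ, AnalyticAt ℂ q z ∧ ∀ᶠ y in 𝓝 z, N y = q y * E y := by
    intro z
    by_cases hz : E z = 0
    · have hfin : analyticOrderAt E z ≠ ⊤ := by
        intro htop
        rw [analyticOrderAt_eq_top] at htop
        exact hx₀ (hEan.eqOn_zero_of_preconnected_of_eventuallyEq_zero isPreconnected_univ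
          (Set.mem_univ z) htop (Set.mem_univ x₀))
      obtain ⟨m, hm⟩ := ENat.ne_top_iff_exists.1 hfin
      obtain ⟨e, he, he0, heE⟩ := ((hE.analyticAt z).analyticOrderAt_eq_natCast (n := m)).1 hm.symm
      have hle := h z hz
      rw [← hm] at hle
      obtain ⟨p, hp, hpN⟩ := (natCast_le_analyticOrderAt (hN.analyticAt z)).1 hle
      refine ⟨fun y => p y / e y, hp.div he he0, ?_⟩
      filter_upwards [heE, hpN, he.continuousAt.eventually_ne he0] with y h1 h2 h3
      rw [h1, h2, smul_eq_mul, smul_eq_mul]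
      field_simp
    · refine ⟨fun y => N y / E y, (hN.analyticAt z).div (hE.analyticAt z) hz, ?_⟩
      filter_upwards [(hE z).continuousAt.eventually_ne hz] with y hy
      rw [div_mul_cancel₀ _ hy]
  choose q hq hqN using hloc
  have hEne : ∀ z, ∀ᶠ y in 𝓝[≠] z, E y ≠ 0 := by
    intro z
    refine ((hE.analyticAt z).eventually_eq_zero_or_eventually_ne_zero).resolve_left fun h0 => ?_
    exact hx₀ (hEan.eqOn_zero_of_preconnected_of_eventuallyEq_zero isPreconnected_univ
          (Set.mem_univ z) h0 (Set.mem_univ x₀))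
  have hloc2 : ∀ z, ∀ᶠ y in 𝓝 z, q y y = q z y := by
    intro z
    have h1 : ∀ᶠ y in 𝓝 z, ∀ᶠ x in 𝓝 y, N x = q z x * E x := (hqN z).eventually_nhds
    have h2 : ∀ᶠ y in 𝓝 z, AnalyticAt ℂ (q z) y := (hq z).eventually_analyticAt
    filter_upwards [h1, h2] with y hy hya
    have hev : q y =ᶠ[𝓝[≠] y] q z := by
      filter_upwards [hEne y, (hqN y).filter_mono nhdsWithin_le_nhds,
        hy.filter_mono nhdsWithin_le_nhds] with x hx h3 h4
      exact mul_right_cancel₀ hx (h3.symm.trans h4)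
    exact tendsto_nhds_unique ((hq y).continuousAt.tendsto.mono_left nhdsWithin_le_nhds)
      ((hya.continuousAt.tendsto.mono_left nhdsWithin_le_nhds).congr' hev.symm)
  refine ⟨fun z => q z z, fun z => ?_, fun z => (hqN z).self_of_nhds⟩
  exact (hq z).differentiableAt.congr_of_eventuallyEq (hloc2 z)

/-- If an entire function has bounded derivative where its modulus is at most one, then its
derivative is controlled by the function, at every point not too far from that set. -/
theorem norm_deriv_le_mul_one_add_norm {f : ℂ → ℂ} (hf : Differentiable ℂ f) {w x : ℂ} {ρ M : ℝ}
    (hx : ‖x - w‖ ≤ ρ) (hfx : ‖f x‖ ≤ 1)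
    (hM : ∀ z, ‖z - w‖ ≤ ρ → ‖f z‖ ≤ 1 → ‖deriv f z‖ ≤ M) :
    ‖deriv f w‖ ≤ 4 * M * (1 + ‖f w‖) := by
  have hM0 : 0 ≤ M := (norm_nonneg _).trans (hM x hx hfx)
  have hfw := norm_nonneg (f w)
  rcases le_or_gt ‖f w‖ 1 with hw | hw
  · have := hM w (by simpa using (norm_nonneg _).trans hx) hw
    nlinarith
  have hcl : IsClosed {z | ‖f z‖ ≤ 1} := isClosed_le hf.continuous.norm continuous_const
  obtain ⟨z₁, hz₁, hdist⟩ := hcl.exists_infDist_eq_dist ⟨x, hfx⟩ w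
  have hle : ‖z₁ - w‖ ≤ ρ := by
    rw [← dist_eq_norm, dist_comm, ← hdist]
    have h1 : infDist w {z | ‖f z‖ ≤ 1} ≤ dist w x := infDist_le_dist_of_mem hfx
    rw [dist_comm, dist_eq_norm] at h1
    exact h1.trans hx
  have hd : 0 < ‖z₁ - w‖ := by
    refine norm_pos_iff.2 (sub_ne_zero.2 ?_)
    rintro rfl
    exact absurd hz₁ (not_le.2 hw)
  have := norm_deriv_le_of_one_lt_norm hf hd (fun z hz => by
    by_contra! hz1
    have h1 : infDist w {z | ‖f z‖ ≤ 1} ≤ dist w z := infDist_le_dist_of_mem hz1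
    rw [hdist, dist_comm w z₁, dist_eq_norm, dist_comm w z] at h1
    exact absurd hz (not_lt.2 h1)) rfl hz₁ (hM z₁ hle hz₁)
  nlinarith

/-- The Zalcman–Pang rescaling procedure. -/
theorem exists_zalcman_rescaling {f : ℂ → ℂ} (hf : Differentiable ℂ f) {k n : ℕ} (hkn : k + 1 ≤ n)
    (hunb : ∀ M : ℝ, ∃ w, ‖f w‖ ≤ 1 ∧ M < ‖deriv f w‖) {R : ℝ} (hR : 1 ≤ R) :
    ∃ (z₀ : ℂ) (τ : ℝ), 0 < τ ∧ τ ≤ 1 / (4 * R) ∧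
      τ ^ (2 * k) + ‖f z₀‖ ^ 2 ≤ τ ^ (n + k) * ‖deriv f z₀‖ ∧
      ∀ z, ‖z - z₀‖ ≤ R * τ ^ n →
        τ ^ (n + k) * ‖deriv f z‖ ≤ 2 ^ (n + k) * (τ ^ (2 * k) + ‖f z‖ ^ 2) := by
  set τ₀ : ℝ := 1 / (4 * R) with hτ₀
  have hτ₀pos : 0 < τ₀ := by positivity
  have hRτ₀ : R * τ₀ = 1 / 4 := by rw [hτ₀]; field_simp
  have hτ₀1 : τ₀ ≤ 1 := by nlinarith
  obtain ⟨w, hw1, hwM⟩ := hunb (2 / τ₀ ^ (n + k))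
  obtain ⟨B, hB⟩ := (isCompact_closedBall w 1).exists_bound_of_continuousOn
    hf.deriv.continuous.continuousOn
  have hBpos : 0 < B :=
    (by positivity : (0 : ℝ) < 2 / τ₀ ^ (n + k)).trans
      (hwM.trans_le (hB w (mem_closedBall_self zero_le_one)))
  set η : ℝ := min τ₀ (1 / B) with hη
  have hηpos : 0 < η := lt_min hτ₀pos (by positivity)
  set S : Set (ℂ × ℝ) := {p | p.1 ∈ closedBall w 1 ∧ p.2 ∈ Set.Icc η 1 ∧
    p.2 ≤ τ₀ * (1 - ‖p.1 - w‖) ∧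
    p.2 ^ (2 * k) + ‖f p.1‖ ^ 2 ≤ p.2 ^ (n + k) * ‖deriv f p.1‖} with hS
  have hc1 : Continuous fun p : ℂ × ℝ => f p.1 := hf.continuous.comp continuous_fst
  have hc2 : Continuous fun p : ℂ × ℝ => deriv f p.1 := hf.deriv.continuous.comp continuous_fst
  have hScpt : IsCompact S := by
    have hcl : IsClosed {p : ℂ × ℝ | p.2 ≤ τ₀ * (1 - ‖p.1 - w‖) ∧
        p.2 ^ (2 * k) + ‖f p.1‖ ^ 2 ≤ p.2 ^ (n + k) * ‖deriv f p.1‖} :=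
      IsClosed.and (isClosed_le (by fun_prop) (by fun_prop))
        (isClosed_le ((continuous_snd.pow _).add (hc1.norm.pow 2))
          ((continuous_snd.pow _).mul hc2.norm))
    refine (((isCompact_closedBall w 1).prod (isCompact_Icc (a := η) (b := 1))).inter_right
      hcl).of_isClosed_subset ?_ ?_
    · refine (isClosed_closedBall.preimage continuous_fst).inter
        ((isClosed_Icc.preimage continuous_snd).inter hcl)
    · rintro p ⟨h1, h2, h3⟩
      exact ⟨⟨h1, h2⟩, h3⟩
  have hSne : S.Nonempty := by
    refine ⟨(w, τ₀), mem_closedBall_self zero_le_one, ⟨min_le_left _ _, hτ₀1⟩, by simp, ?_⟩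
    have h1 : τ₀ ^ (2 * k) ≤ 1 := pow_le_one₀ hτ₀pos.le hτ₀1
    have h2 : ‖f w‖ ^ 2 ≤ 1 := pow_le_one₀ (norm_nonneg _) hw1
    rw [div_lt_iff₀ (by positivity)] at hwM
    simp only
    linarith
  have hδpos : ∀ p ∈ S, 0 < 1 - ‖p.1 - w‖ := by
    rintro p ⟨_, h2, h3, _⟩
    have := hηpos.trans_le (h2.1.trans h3)
    exact pos_of_mul_pos_right this hτ₀pos.le
  have hcont : ContinuousOn (fun p : ℂ × ℝ => p.2 / (1 - ‖p.1 - w‖)) S :=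
    ContinuousOn.div (by fun_prop) (by fun_prop) (fun p hp => (hδpos p hp).ne')
  obtain ⟨⟨z₀, τ⟩, hmem, hmin⟩ := hScpt.exists_isMinOn hSne hcont
  have hδ := hδpos _ hmem
  obtain ⟨hz₀, ⟨hτη, hτ1⟩, hτδ, hineq⟩ := hmem
  simp only at hz₀ hτη hτ1 hτδ hineq hδ
  have hτpos := hηpos.trans_le hτη
  have hττ₀ : τ ≤ τ₀ := by nlinarith [norm_nonneg (z₀ - w)]
  refine ⟨z₀, τ, hτpos, hττ₀, hineq, fun z hz => ?_⟩
  have hτn : τ ^ n ≤ τ := pow_le_of_le_one hτpos.le hτ1 (by omega)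
  have hdz : 3 / 4 * (1 - ‖z₀ - w‖) ≤ 1 - ‖z - w‖ := by
    have h1 : ‖z - w‖ ≤ ‖z - z₀‖ + ‖z₀ - w‖ := norm_sub_le_norm_sub_add_norm_sub _ _ _
    have h2 : R * τ ^ n ≤ R * τ := by gcongr
    have h3 : R * τ ≤ R * (τ₀ * (1 - ‖z₀ - w‖)) := by gcongr
    rw [← mul_assoc, hRτ₀] at h3
    linarith
  have hdz0 : 0 < 1 - ‖z - w‖ := lt_of_lt_of_le (by positivity) hdz
  have hzmem : z ∈ closedBall w 1 := by
    rw [mem_closedBall, dist_eq_norm]; linarith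
  have hkey : (τ / 2) ^ (n + k) * ‖deriv f z‖ ≤ (τ / 2) ^ (2 * k) + ‖f z‖ ^ 2 := by
    by_contra! hlt
    have hη' : η ≤ τ / 2 := by
      refine (min_le_right _ _).trans ?_
      rw [div_le_iff₀ hBpos]
      have h1 : (τ / 2) ^ (2 * k) * 1 ≤ (τ / 2) ^ (2 * k) * ((τ / 2) ^ (n - k) * ‖deriv f z‖) := by
        rw [← mul_assoc, ← pow_add, show 2 * k + (n - k) = n + k by omega]
        nlinarith [norm_nonneg (f z)]
      have h2 := le_of_mul_le_mul_left h1 (by positivity)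
      have h3 : (τ / 2) ^ (n - k) ≤ τ / 2 :=
        pow_le_of_le_one (by positivity) (by linarith) (by omega)
      have h4 := hB z hzmem
      calc 1 ≤ (τ / 2) ^ (n - k) * ‖deriv f z‖ := h2
        _ ≤ τ / 2 * B := by gcongr
    have hmem' : (z, τ / 2) ∈ S := ⟨hzmem, ⟨hη', by simp only; linarith⟩, by
      simp only
      nlinarith, hlt.le⟩
    have := hmin hmem'
    simp only [Set.mem_ofPred_eq] at this
    rw [div_le_div_iff₀ hδ hdz0] at this
    nlinarith
  have h2 : (τ / 2) ^ (2 * k) ≤ τ ^ (2 * k) := by gcongr; linarith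
  rw [div_pow, div_mul_eq_mul_div, div_le_iff₀ (by positivity)] at hkey
  have h3 : (0 : ℝ) < 2 ^ (n + k) := by positivity
  nlinarith

theorem differentiable_iteratedDeriv {f : ℂ → ℂ} (hf : Differentiable ℂ f) (m : ℕ) :
    Differentiable ℂ (iteratedDeriv m f) := by
  induction m with
  | zero => simpa using hf
  | succ m ih => rw [iteratedDeriv_succ]; exact ih.deriv

/-- A spherical-derivative bound on a large disc forces exponential growth on a smaller one,
provided the function is steep at the centre. -/
theorem one_add_norm_le_of_spherical_bound {g : ℂ → ℂ} (hg : Differentiable ℂ g) {M R : ℝ}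
    (hM : 0 < M) (h0 : 1 + ‖g 0‖ ^ 2 ≤ ‖deriv g 0‖)
    (hb : ∀ z, ‖z‖ ≤ R → ‖deriv g z‖ ≤ M * (1 + ‖g z‖ ^ 2)) {z : ℂ} (hz : ‖z‖ ≤ (R - 2) / 2) :
    1 + ‖g z‖ ≤ (8 * M + 2) * Real.exp (8 * M * ‖z‖) := by
  obtain ⟨x, hx2, hx1⟩ : ∃ x, ‖x‖ ≤ 2 ∧ ‖g x‖ ≤ 1 := by
    by_contra! hcon
    have hlt : ∀ y ∈ ball (0 : ℂ) 2, 1 < ‖g y‖ := fun y hy => hcon y (mem_ball_zero_iff.1 hy).le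
    have hmem : (0 : ℂ) ∈ ball (0 : ℂ) 2 := mem_ball_self two_pos
    obtain ⟨h, hh, hgh⟩ := exists_log_on_ball (w := 0) (d := 2) hg.differentiableOn
      (fun y hy => norm_pos_iff.1 (one_pos.trans (hlt y hy)))
    have hre : ∀ y ∈ ball (0 : ℂ) 2, ‖g y‖ = Real.exp (h y).re := by
      intro y hy
      rw [hgh y hy, Complex.norm_exp]
    have key := norm_deriv_le_of_re_pos two_pos hh (fun y hy => by
      rw [← Real.one_lt_exp_iff, ← hre y hy]
      exact hlt y hy)
    have hder : deriv g 0 = g 0 * deriv h 0 := by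
      have e1 : g =ᶠ[𝓝 0] fun z => Complex.exp (h z) :=
        eventuallyEq_of_mem (isOpen_ball.mem_nhds hmem) hgh
      rw [e1.deriv_eq, (hh.differentiableAt (isOpen_ball.mem_nhds hmem)).hasDerivAt.cexp.deriv,
        ← hgh 0 hmem]
    rw [hder, norm_mul] at h0
    have h1 := hlt 0 hmem
    have h2 := Real.add_one_le_exp (h 0).re
    rw [← hre 0 hmem] at h2
    nlinarith
  have hlin : ∀ w, ‖w - 0‖ ≤ (R - 2) / 2 → ‖deriv g w‖ ≤ 8 * M * (1 + ‖g w‖) := by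
    intro w hw
    rw [sub_zero] at hw
    have := norm_deriv_le_mul_one_add_norm hg (w := w) (x := x) (ρ := ‖w‖ + 2) (M := 2 * M)
      (by linarith [norm_sub_le x w]) hx1 (fun y hy hy1 => by
        have h1 := norm_sub_norm_le y w
        have h2 := hb y (by linarith)
        have h3 : ‖g y‖ ^ 2 ≤ 1 := pow_le_one₀ (norm_nonneg _) hy1
        nlinarith)
    linarith
  have hgr := one_add_norm_le_mul_exp hg (by positivity : 0 < 8 * M) hlin (by simpa using hz)
  have hz0 := hlin 0 (by simpa using (norm_nonneg z).trans hz)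
  have hg0 : 1 + ‖g 0‖ ≤ 8 * M + 2 := by nlinarith [norm_nonneg (g 0)]
  rw [sub_zero] at hgr
  exact hgr.trans (by gcongr)

/-- If the derivative of `f` is unbounded on `{‖f‖ ≤ 1}` and `f ^ n = 1` wherever
`(f ^ n)⁽ᵏ⁾ = 1`, then a rescaling limit of `f` is an entire function of exponential type for which
`(g ^ n)⁽ᵏ⁾` omits the value `1` or is identically `1`. -/
theorem exists_rescaling_limit {f : ℂ → ℂ} (hf : Differentiable ℂ f) {k n : ℕ} (hk : 1 ≤ k)
    (hkn : k + 1 ≤ n) (hunb : ∀ M : ℝ, ∃ w, ‖f w‖ ≤ 1 ∧ M < ‖deriv f w‖)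
    (hshare : ∀ z, iteratedDeriv k (fun w => f w ^ n) z = 1 → f z ^ n = 1) :
    ∃ (g : ℂ → ℂ) (K L : ℝ), 0 < K ∧ 0 ≤ L ∧ Differentiable ℂ g ∧ deriv g 0 ≠ 0 ∧
      (∀ z, ‖g z‖ ≤ K * Real.exp (L * ‖z‖)) ∧
      ((∀ z, iteratedDeriv k (fun w => g w ^ n) z ≠ 1) ∨
        ∀ z, iteratedDeriv k (fun w => g w ^ n) z = 1) := by
  have hR : ∀ j : ℕ, (1 : ℝ) ≤ j + 2 := fun j => by
    have : (0 : ℝ) ≤ j := j.cast_nonneg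
    linarith
  choose z τ hτ hτ1 hbig hsph using fun j : ℕ => exists_zalcman_rescaling hf hkn hunb (hR j)
  set G : ℕ → ℂ → ℂ := fun j ζ => ((τ j : ℂ) ^ k)⁻¹ * f (z j + (τ j : ℂ) ^ n * ζ) with hG
  have hτ0 : ∀ j, (τ j : ℂ) ≠ 0 := fun j => Complex.ofReal_ne_zero.2 (hτ j).ne'
  have hτn : ∀ j, ‖(τ j : ℂ)‖ = τ j := fun j => by
    rw [Complex.norm_real, Real.norm_of_nonneg (hτ j).le]
  have haff : ∀ j ζ, HasDerivAt (fun ζ : ℂ => z j + (τ j : ℂ) ^ n * ζ) ((τ j : ℂ) ^ n) ζ := by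
    intro j ζ
    simpa using ((hasDerivAt_id ζ).const_mul ((τ j : ℂ) ^ n)).const_add (z j)
  have hGder : ∀ j ζ, HasDerivAt (G j)
      (((τ j : ℂ) ^ k)⁻¹ * (deriv f (z j + (τ j : ℂ) ^ n * ζ) * (τ j : ℂ) ^ n)) ζ := by
    intro j ζ
    exact (((hf _).hasDerivAt.comp ζ (haff j ζ))).const_mul _
  have hGd : ∀ j, Differentiable ℂ (G j) := fun j ζ => (hGder j ζ).differentiableAt
  have hGnorm : ∀ j ζ, ‖G j ζ‖ ^ 2 * τ j ^ (2 * k) = ‖f (z j + (τ j : ℂ) ^ n * ζ)‖ ^ 2 := by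
    intro j ζ
    have := hτ j
    simp only [hG, norm_mul, norm_inv, norm_pow, hτn]
    field_simp
    ring
  have hGdnorm : ∀ j ζ, ‖deriv (G j) ζ‖ * τ j ^ (2 * k) =
      τ j ^ (n + k) * ‖deriv f (z j + (τ j : ℂ) ^ n * ζ)‖ := by
    intro j ζ
    have := hτ j
    simp only [(hGder j ζ).deriv, norm_mul, norm_inv, norm_pow, hτn]
    field_simp
    ring
  set M : ℝ := 2 ^ (n + k) with hM
  have hMpos : 0 < M := by positivity
  have hb : ∀ (j : ℕ) (ζ : ℂ), ‖ζ‖ ≤ (j : ℝ) / 2 →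
      1 + ‖G j ζ‖ ≤ (8 * M + 2) * Real.exp (8 * M * ‖ζ‖) := by
    intro j ζ hζ
    have hpos : 0 < τ j ^ (2 * k) := pow_pos (hτ j) _
    refine one_add_norm_le_of_spherical_bound (hGd j) hMpos (R := j + 2) ?_ ?_ (by simpa using hζ)
    · refine le_of_mul_le_mul_right ?_ hpos
      rw [hGdnorm, add_mul, hGnorm]
      simpa using hbig j
    · intro y hy
      refine le_of_mul_le_mul_right ?_ hpos
      rw [hGdnorm, mul_assoc, add_mul, hGnorm, one_mul]
      refine hsph j _ ?_
      rw [add_sub_cancel_left, norm_mul, norm_pow, hτn, mul_comm]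
      gcongr
      exact pow_nonneg (hτ j).le _
  set 𝓤 : Ultrafilter ℕ := hyperfilter ℕ
  have h𝓤 : (𝓤 : Filter ℕ) ≤ atTop := Nat.hyperfilter_le_atTop
  have hlarge : ∀ x : ℝ, ∀ᶠ j : ℕ in (𝓤 : Filter ℕ), x ≤ (j : ℝ) / 2 := by
    intro x
    refine h𝓤 ?_
    filter_upwards [tendsto_natCast_atTop_atTop.eventually_ge_atTop (2 * x)] with j hj
    linarith
  have hbr : ∀ r : ℝ, ∀ᶠ j in (𝓤 : Filter ℕ), ∀ y, ‖y‖ ≤ r →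
      ‖G j y‖ ≤ (8 * M + 2) * Real.exp (8 * M * r) := by
    intro r
    filter_upwards [hlarge r] with j hj y hy
    have h1 := hb j y (hy.trans hj)
    have h2 : (8 * M + 2) * Real.exp (8 * M * ‖y‖) ≤ (8 * M + 2) * Real.exp (8 * M * r) := by
      gcongr
    linarith
  have hloc : ∀ x ∈ (Set.univ : Set ℂ), ∀ᶠ j in (𝓤 : Filter ℕ), ∀ y ∈ ball x 1,
      ‖G j y‖ ≤ (8 * M + 2) * Real.exp (8 * M * (‖x‖ + 1)) := by
    intro x _
    filter_upwards [hbr (‖x‖ + 1)] with j hj y hy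
    refine hj y ?_
    rw [mem_ball, dist_eq_norm] at hy
    linarith [norm_sub_norm_le y x]
  obtain ⟨g, hg⟩ := exists_tendstoLocallyUniformlyOn_of_bounded 𝓤 hGd (U := Set.univ)
    (fun x hx => ⟨1, one_pos, _, hloc x hx⟩)
  have hGnd : ∀ j, Differentiable ℂ fun ζ => G j ζ ^ n := fun j => (hGd j).pow n
  obtain ⟨g', hg'⟩ := exists_tendstoLocallyUniformlyOn_of_bounded 𝓤 hGnd (U := Set.univ)
    (fun x hx => ⟨1, one_pos, ((8 * M + 2) * Real.exp (8 * M * (‖x‖ + 1))) ^ n, by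
      filter_upwards [hloc x hx] with j hj y hy
      rw [norm_pow]
      exact pow_le_pow_left₀ (norm_nonneg _) (hj y hy) n⟩)
  have hgg' : g' = fun w => g w ^ n := funext fun x =>
    tendsto_nhds_unique (hg'.tendsto_at (Set.mem_univ x))
      ((hg.tendsto_at (Set.mem_univ x)).pow n)
  have hgd : Differentiable ℂ g := differentiableOn_univ.1
    (hg.differentiableOn (Eventually.of_forall fun j => (hGd j).differentiableOn) isOpen_univ)
  have hiter : ∀ m, TendstoLocallyUniformlyOn (fun j => iteratedDeriv m fun ζ => G j ζ ^ n)
      (iteratedDeriv m g') 𝓤 Set.univ := by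
    intro m
    induction m with
    | zero => simpa using hg'
    | succ m ih =>
      have := ih.deriv (Eventually.of_forall fun j =>
        (differentiable_iteratedDeriv (hGnd j) m).differentiableOn) isOpen_univ
      simp only [iteratedDeriv_succ]
      exact this
  have hFd : Differentiable ℂ fun w => f w ^ n := hf.pow n
  have hGk : ∀ j ζ, iteratedDeriv k (fun ζ => G j ζ ^ n) ζ =
      iteratedDeriv k (fun w => f w ^ n) (z j + (τ j : ℂ) ^ n * ζ) := by
    intro j ζ
    have h1 : (fun ζ => G j ζ ^ n) = fun ζ => (((τ j : ℂ) ^ k)⁻¹) ^ n *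
        (fun y => (fun w => f w ^ n) (z j + y)) ((τ j : ℂ) ^ n * ζ) := by
      funext ζ
      simp only [hG, mul_pow]
    have h2 : ContDiff ℂ k fun y => (fun w => f w ^ n) (z j + y) :=
      (hFd.comp (differentiable_id.const_add (z j))).contDiff
    rw [h1, iteratedDeriv_const_mul_field, iteratedDeriv_comp_const_mul h2,
      iteratedDeriv_comp_const_add k (fun w => f w ^ n)]
    simp only
    rw [← mul_assoc, ← inv_pow, ← pow_mul, ← pow_mul, mul_comm n k,
      ← mul_pow, inv_mul_cancel₀ (hτ0 j), one_pow, one_mul]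
  have hhur := hurwitz_entire (𝓤 := (𝓤 : Filter ℕ))
    (E := fun j ζ => iteratedDeriv k (fun ζ => G j ζ ^ n) ζ - 1)
    (g := fun ζ => iteratedDeriv k g' ζ - 1)
    (fun j => (differentiable_iteratedDeriv (hGnd j) k).sub_const 1)
    (by
      have h1 := hiter k
      rw [Metric.tendstoLocallyUniformlyOn_iff] at h1 ⊢
      simpa only [dist_sub_right] using h1)
    (by
      intro r
      set C := (8 * M + 2) * Real.exp (8 * M * r)
      filter_upwards [hbr r, hlarge C] with j hj hjC ζ hζ h0
      have h1 : f (z j + (τ j : ℂ) ^ n * ζ) ^ n = 1 := by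
        refine hshare _ ?_
        rw [← hGk]
        exact sub_eq_zero.1 h0
      have h2 : ‖f (z j + (τ j : ℂ) ^ n * ζ)‖ = 1 := by
        have := congrArg norm h1
        rw [norm_pow, norm_one] at this
        exact (pow_eq_one_iff_of_nonneg (norm_nonneg _) (by omega)).1 this
      have h3 := hj ζ (mem_ball_zero_iff.1 hζ).le
      have hj0 : (0 : ℝ) ≤ j := j.cast_nonneg
      have h4 : τ j ^ k ≤ 1 / (4 * (j + 2)) := by
        refine (pow_le_of_le_one (hτ j).le ((hτ1 j).trans ?_) (by omega)).trans (hτ1 j)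
        rw [div_le_one (by positivity)]
        linarith
      simp only [hG, norm_mul, norm_inv, norm_pow, hτn, h2, mul_one] at h3
      have h5 := h3.trans hjC
      have hpos : 0 < τ j ^ k := pow_pos (hτ j) k
      rw [inv_le_iff_one_le_mul₀ hpos] at h5
      rw [le_div_iff₀ (by positivity)] at h4
      nlinarith)
  refine ⟨g, 8 * M + 2, 8 * M, by positivity, by positivity, hgd, ?_, ?_, ?_⟩
  · have h1 := (hg.deriv (Eventually.of_forall fun j => (hGd j).differentiableOn)
      isOpen_univ).tendsto_at (Set.mem_univ 0)
    have h2 : 1 ≤ ‖deriv g 0‖ := by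
      refine ge_of_tendsto h1.norm (Eventually.of_forall fun j => ?_)
      have hpos : 0 < τ j ^ (2 * k) := pow_pos (hτ j) _
      refine le_of_mul_le_mul_right ?_ hpos
      simp only [Function.comp]
      rw [hGdnorm]
      have := hbig j
      simp only [mul_zero, add_zero]
      nlinarith [norm_nonneg (f (z j))]
    exact norm_pos_iff.1 (one_pos.trans_le h2)
  · intro x
    refine le_of_tendsto (hg.tendsto_at (Set.mem_univ x)).norm ?_
    filter_upwards [hbr ‖x‖] with j hj using hj x le_rfl
  · rw [hgg'] at hhur
    exact hhur.imp (fun h z => sub_ne_zero.1 (h z)) (fun h z => sub_eq_zero.1 (h z))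

/-- The cofactors in `(f ^ n)⁽ʲ⁾ = f ^ (n - j) * powDerivCofactor f n j`. -/
noncomputable def powDerivCofactor (f : ℂ → ℂ) (n : ℕ) : ℕ → ℂ → ℂ
  | 0 => fun _ => 1
  | j + 1 => fun z => ((n - j : ℕ) : ℂ) * deriv f z * powDerivCofactor f n j z +
      f z * deriv (powDerivCofactor f n j) z

theorem differentiable_powDerivCofactor {f : ℂ → ℂ} (hf : Differentiable ℂ f) (n j : ℕ) :
    Differentiable ℂ (powDerivCofactor f n j) := by
  induction j with
  | zero => exact differentiable_const _
  | succ j ih => exact ((hf.deriv.const_mul _).mul ih).add (hf.mul ih.deriv)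

theorem iteratedDeriv_pow_eq_powDerivCofactor {f : ℂ → ℂ} (hf : Differentiable ℂ f) {n j : ℕ}
    (hj : j ≤ n) (z : ℂ) :
    iteratedDeriv j (fun w => f w ^ n) z = f z ^ (n - j) * powDerivCofactor f n j z := by
  induction j generalizing z with
  | zero => simp [powDerivCofactor]
  | succ j ih =>
    rw [iteratedDeriv_succ, show iteratedDeriv j (fun w => f w ^ n) = _ from
      funext (ih (by omega))]
    have h1 := ((hf z).hasDerivAt.pow (n - j)).mul
      (differentiable_powDerivCofactor hf n j z).hasDerivAt
    refine h1.deriv.trans ?_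
    rw [show n - j = n - (j + 1) + 1 by omega]
    simp only [powDerivCofactor, Pi.pow_apply, Nat.add_sub_cancel]
    rw [show n - j = n - (j + 1) + 1 by omega]
    push_cast
    ring

theorem iteratedDeriv_pow_eq_zero {f : ℂ → ℂ} (hf : Differentiable ℂ f) {n j : ℕ} (hj : j < n)
    {z : ℂ} (hz : f z = 0) : iteratedDeriv j (fun w => f w ^ n) z = 0 := by
  rw [iteratedDeriv_pow_eq_powDerivCofactor hf hj.le, hz, zero_pow (by omega), zero_mul]

theorem exists_norm_iteratedDeriv_le_exp {u : ℂ → ℂ} (hu : Differentiable ℂ u) {K L : ℝ}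
    (hK : 0 < K) (hL : 0 ≤ L) (hb : ∀ z, ‖u z‖ ≤ K * Real.exp (L * ‖z‖)) (m : ℕ) :
    ∃ K', 0 < K' ∧ ∀ z, ‖iteratedDeriv m u z‖ ≤ K' * Real.exp (L * ‖z‖) := by
  induction m with
  | zero => exact ⟨K, hK, by simpa using hb⟩
  | succ m ih =>
    obtain ⟨K', hK', h⟩ := ih
    refine ⟨K' * Real.exp L, by positivity, fun z => ?_⟩
    rw [iteratedDeriv_succ, mul_assoc, ← Real.exp_add, ← div_one (K' * _)]
    refine Complex.norm_deriv_le_of_forall_mem_sphere_norm_le one_pos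
      (differentiable_iteratedDeriv hu m).diffContOnCl fun y hy => (h y).trans ?_
    have : ‖y‖ ≤ 1 + ‖z‖ := by
      rw [mem_sphere, dist_eq_norm] at hy
      linarith [norm_sub_norm_le y z]
    gcongr
    nlinarith

theorem exists_iteratedDeriv_polynomial_mul_exp (p : Polynomial ℂ) (a b : ℂ) (m : ℕ) :
    ∃ q : Polynomial ℂ, ∀ z, iteratedDeriv m (fun z => p.eval z * Complex.exp (a * z + b)) z =
      q.eval z * Complex.exp (a * z + b) := by
  induction m with
  | zero => exact ⟨p, by simp⟩
  | succ m ih =>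
    obtain ⟨q, hq⟩ := ih
    refine ⟨q.derivative + Polynomial.C a * q, fun z => ?_⟩
    rw [iteratedDeriv_succ, show iteratedDeriv m _ = _ from funext hq]
    have h1 : HasDerivAt (fun z : ℂ => a * z + b) a z := by
      simpa using ((hasDerivAt_id z).const_mul a).add_const b
    refine ((q.hasDerivAt z).mul h1.cexp).deriv.trans ?_
    simp
    ring

theorem iteratedDeriv_exp_affine (a b : ℂ) (m : ℕ) :
    iteratedDeriv m (fun z => Complex.exp (a * z + b)) =
      fun z => a ^ m * Complex.exp (a * z + b) := by
  have h : (fun z => Complex.exp (a * z + b)) = fun z => Complex.exp b * Complex.exp (a * z) := by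
    funext z
    rw [Complex.exp_add, mul_comm]
  funext z
  rw [h, iteratedDeriv_const_mul_field, iteratedDeriv_cexp_const_mul, Complex.exp_add]
  ring

theorem exp_affine_pow (a b : ℂ) (n : ℕ) (z : ℂ) :
    Complex.exp (a * z + b) ^ n = Complex.exp (n * a * z + n * b) := by
  rw [← Complex.exp_nat_mul]
  ring_nf

theorem exists_exp_affine_eq {a b : ℂ} (ha : a ≠ 0) {y : ℂ} (hy : y ≠ 0) :
    ∃ z, Complex.exp (a * z + b) = y :=
  ⟨(Complex.log y - b) / a, by
    rw [mul_div_cancel₀ _ ha, sub_add_cancel, Complex.exp_log hy]⟩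

/-- A zero of `f` at which `(f ^ n)⁽ᵏ⁺¹⁾` does not vanish, `k < n`, is simple. -/
theorem deriv_ne_zero_of_iteratedDeriv_pow_ne_zero {f : ℂ → ℂ} (hf : Differentiable ℂ f) {n k : ℕ}
    (hkn : k + 1 ≤ n) {z : ℂ} (hz : f z = 0)
    (h : iteratedDeriv (k + 1) (fun w => f w ^ n) z ≠ 0) : deriv f z ≠ 0 := by
  intro h0
  rw [iteratedDeriv_pow_eq_powDerivCofactor hf hkn] at h
  refine h ?_
  simp [powDerivCofactor, hz, h0]

/-- An entire function of exponential type with a simple zero and no other zeros. -/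
theorem exists_eq_linear_mul_exp {g : ℂ → ℂ} (hg : Differentiable ℂ g) {K L : ℝ} (hK : 0 < K)
    (hL : 0 ≤ L) (hb : ∀ z, ‖g z‖ ≤ K * Real.exp (L * ‖z‖)) {z₀ : ℂ} (hz₀ : g z₀ = 0)
    (hd : deriv g z₀ ≠ 0) (huniq : ∀ z, g z = 0 → z = z₀) :
    ∃ a b : ℂ, ∀ z, g z = (z - z₀) * Complex.exp (a * z + b) := by
  have hdiff : Differentiable ℂ (dslope g z₀) := differentiableOn_univ.1
    ((Complex.differentiableOn_dslope univ_mem).2 hg.differentiableOn)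
  have heq : ∀ z, g z = (z - z₀) * dslope g z₀ z := by
    intro z
    have := sub_smul_dslope g z₀ z
    rw [hz₀, sub_zero, smul_eq_mul] at this
    exact this.symm
  have hne : ∀ z, dslope g z₀ z ≠ 0 := by
    intro z h0
    rcases eq_or_ne z z₀ with rfl | hz
    · rw [dslope_same] at h0
      exact hd h0
    · exact hz (huniq z (by rw [heq, h0, mul_zero]))
  obtain ⟨C, hC⟩ := (isCompact_closedBall z₀ 1).exists_bound_of_continuousOn
    hdiff.continuous.continuousOn
  obtain ⟨a, b, hab⟩ := exists_eq_exp_affine hdiff hne (K := max K C) (lt_max_of_lt_left hK) hL (by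
    intro z
    rcases le_or_gt (dist z z₀) 1 with hz | hz
    · refine (hC z hz).trans ?_
      have h1 : 1 ≤ Real.exp (L * ‖z‖) := Real.one_le_exp (by positivity)
      have h2 : C ≤ max K C := le_max_right _ _
      have h3 : 0 < max K C := lt_max_of_lt_left hK
      nlinarith
    · refine le_trans ?_ ((hb z).trans (mul_le_mul_of_nonneg_right (le_max_left _ _)
        (Real.exp_pos _).le))
      rw [heq z, norm_mul, ← dist_eq_norm]
      nlinarith [norm_nonneg (dslope g z₀ z)])
  exact ⟨a, b, fun z => by rw [heq, hab]⟩

/-- A nonconstant entire function `g` of exponential type with `(g ^ n)⁽ᵏ⁾` omitting the value `1`,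
or identically `1`, does not exist for `n > k`. -/
theorem false_of_iteratedDeriv_pow_omits_one {g : ℂ → ℂ} (hg : Differentiable ℂ g) {k n : ℕ}
    (hk : 1 ≤ k) (hkn : k + 1 ≤ n) {K L : ℝ} (hK : 0 < K) (hL : 0 ≤ L)
    (hb : ∀ z, ‖g z‖ ≤ K * Real.exp (L * ‖z‖)) {x : ℂ} (hx : deriv g x ≠ 0)
    (h : (∀ z, iteratedDeriv k (fun w => g w ^ n) z ≠ 1) ∨
      ∀ z, iteratedDeriv k (fun w => g w ^ n) z = 1) : False := by
  have hn0 : (n : ℂ) ≠ 0 := Nat.cast_ne_zero.2 (by omega)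
  by_cases hzero : ∀ z, g z ≠ 0
  · obtain ⟨a, b, hab⟩ := exists_eq_exp_affine hg hzero hK hL hb
    have ha : a ≠ 0 := by
      rintro rfl
      rw [show g = fun _ => Complex.exp b from funext fun z => by rw [hab]; simp] at hx
      simp at hx
    have hna : (n : ℂ) * a ≠ 0 := mul_ne_zero hn0 ha
    have hG : (fun w => g w ^ n) = fun z => Complex.exp (n * a * z + n * b) :=
      funext fun z => by rw [hab, exp_affine_pow]
    rw [hG, iteratedDeriv_exp_affine] at h
    have hval : ∀ y : ℂ, y ≠ 0 → ∃ z, (n * a) ^ k * Complex.exp (n * a * z + n * b) = y := by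
      intro y hy
      obtain ⟨z, hz⟩ := exists_exp_affine_eq (b := n * b) hna
        (div_ne_zero hy (pow_ne_zero k hna))
      exact ⟨z, by rw [hz]; field_simp⟩
    rcases h with h | h
    · obtain ⟨z, hz⟩ := hval 1 one_ne_zero
      exact h z hz
    · obtain ⟨z, hz⟩ := hval 2 two_ne_zero
      have h1 := h z
      simp only [hz] at h1
      norm_num at h1
  push Not at hzero
  obtain ⟨z₀, hz₀⟩ := hzero
  have hGd : Differentiable ℂ fun w => g w ^ n := hg.pow n
  have hHz : ∀ z, g z = 0 → iteratedDeriv k (fun w => g w ^ n) z = 0 :=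
    fun z hz => iteratedDeriv_pow_eq_zero hg (by omega) hz
  have hne : ∀ z, iteratedDeriv k (fun w => g w ^ n) z ≠ 1 := by
    refine h.resolve_right fun h1 => ?_
    have := h1 z₀
    rw [hHz z₀ hz₀] at this
    exact zero_ne_one this
  obtain ⟨K', hK', hb'⟩ := exists_norm_iteratedDeriv_le_exp hGd (pow_pos hK n)
    (mul_nonneg n.cast_nonneg hL) (fun z => by
      rw [norm_pow, mul_assoc, Real.exp_nat_mul, ← mul_pow]
      exact pow_le_pow_left₀ (norm_nonneg _) (hb z) n) k
  obtain ⟨a, b, hab⟩ := exists_eq_exp_affine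
    ((differentiable_iteratedDeriv hGd k).sub_const 1) (fun z => sub_ne_zero.2 (hne z))
    (K := K' + 1) (by positivity) (mul_nonneg n.cast_nonneg hL) (fun z => by
      refine (norm_sub_le _ _).trans ?_
      have := hb' z
      have h1 : 1 ≤ Real.exp (n * L * ‖z‖) := Real.one_le_exp (by positivity)
      rw [norm_one]
      linarith)
  have hH : ∀ z, iteratedDeriv k (fun w => g w ^ n) z = 1 + Complex.exp (a * z + b) :=
    fun z => by rw [← hab z]; ring
  rcases eq_or_ne a 0 with rfl | ha
  · have hzero : ∀ z, iteratedDeriv k (fun w => g w ^ n) z = 0 * g z ^ n := by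
      intro z
      have h1 := hHz z₀ hz₀
      rw [hH] at h1
      rw [hH, zero_mul z, ← zero_mul z₀, h1, zero_mul, zero_mul]
    have hall := eq_zero_of_iteratedDeriv_eq_mul hGd hk hzero (z₀ := z₀)
      (fun i hi => iteratedDeriv_pow_eq_zero hg (by omega) hz₀)
    have : g = fun _ => 0 := funext fun z => pow_eq_zero_iff (by omega) |>.1 (hall z)
    rw [this] at hx
    simp at hx
  have hexp : ∀ z, g z = 0 → Complex.exp (a * z + b) = -1 := by
    intro z hz
    have := hHz z hz
    rw [hH] at this
    linear_combination this
  have haff : ∀ z, HasDerivAt (fun z : ℂ => a * z + b) a z := fun z => by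
    simpa using ((hasDerivAt_id z).const_mul a).add_const b
  have huniq : ∀ z, g z = 0 → z = z₀ := by
    intro z hz
    have hder : ∀ y, HasDerivAt (fun y => iteratedDeriv (k - 1) (fun w => g w ^ n) y -
        (y + Complex.exp (a * y + b) / a)) 0 y := by
      intro y
      have h1 := (differentiable_iteratedDeriv hGd (k - 1) y).hasDerivAt
      rw [← iteratedDeriv_succ, Nat.sub_add_cancel hk, hH] at h1
      refine (h1.sub ((hasDerivAt_id y).add ((haff y).cexp.div_const a))).congr_deriv ?_
      field_simp
      ring
    have hc := is_const_of_deriv_eq_zero (fun y => (hder y).differentiableAt)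
      (fun y => (hder y).deriv) z z₀
    simp only [hexp z hz, hexp z₀ hz₀, iteratedDeriv_pow_eq_zero hg (show k - 1 < n by omega) hz,
      iteratedDeriv_pow_eq_zero hg (show k - 1 < n by omega) hz₀] at hc
    linear_combination -hc
  have hH' : deriv (iteratedDeriv k fun w => g w ^ n) z₀ = -a := by
    rw [show iteratedDeriv k (fun w => g w ^ n) = _ from funext hH]
    refine ((haff z₀).cexp.const_add 1).deriv.trans ?_
    rw [hexp z₀ hz₀]
    ring
  have hsimple := deriv_ne_zero_of_iteratedDeriv_pow_ne_zero hg hkn hz₀ (by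
    rw [iteratedDeriv_succ, hH']
    exact neg_ne_zero.2 ha)
  obtain ⟨α, β, hg1⟩ := exists_eq_linear_mul_exp hg hK hL hb hz₀ hsimple huniq
  obtain ⟨q, hq⟩ := exists_iteratedDeriv_polynomial_mul_exp
    ((Polynomial.X - Polynomial.C z₀) ^ n) (n * α) (n * β) k
  have hG : (fun w => g w ^ n) = fun z => ((Polynomial.X - Polynomial.C z₀) ^ n).eval z *
      Complex.exp (n * α * z + n * β) := by
    funext z
    rw [hg1, mul_pow, exp_affine_pow]
    simp
  rw [← hG] at hq
  have hq0 : q = 0 := by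
    refine q.eq_zero_of_infinite_isRoot ?_
    refine Set.infinite_of_injective_forall_mem
      (f := fun m : ℕ => z₀ + m * (2 * Real.pi * Complex.I) / a) ?_ ?_
    · intro m m' hmm
      simpa [ha, Complex.I_ne_zero, Real.pi_ne_zero] using hmm
    · intro m
      have h1 := hq (z₀ + m * (2 * Real.pi * Complex.I) / a)
      rw [hH, show a * (z₀ + m * (2 * Real.pi * Complex.I) / a) + b =
        (a * z₀ + b) + m * (2 * Real.pi * Complex.I) by field_simp; ring,
        Complex.exp_add, hexp z₀ hz₀, Complex.exp_nat_mul_two_pi_mul_I] at h1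
      have h2 : q.eval (z₀ + m * (2 * Real.pi * Complex.I) / a) *
        Complex.exp (n * α * (z₀ + m * (2 * Real.pi * Complex.I) / a) + n * β) = 0 := by
        rw [← h1]; ring
      exact (mul_eq_zero.1 h2).resolve_right (Complex.exp_ne_zero _)
  rw [show iteratedDeriv k (fun w => g w ^ n) = fun _ => 0 from
    funext fun z => by rw [hq, hq0]; simp] at hH'
  simp at hH'
  exact ha hH'

/-- If `f ^ n = 1` wherever `(f ^ n)⁽ᵏ⁾ = 1`, `n > k`, then `f'` is bounded on `{‖f‖ ≤ 1}`. -/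
theorem exists_norm_deriv_le_of_norm_le_one {f : ℂ → ℂ} (hf : Differentiable ℂ f) {k n : ℕ}
    (hk : 1 ≤ k) (hkn : k + 1 ≤ n)
    (hshare : ∀ z, iteratedDeriv k (fun w => f w ^ n) z = 1 → f z ^ n = 1) :
    ∃ M : ℝ, ∀ w, ‖f w‖ ≤ 1 → ‖deriv f w‖ ≤ M := by
  by_contra! hunb
  obtain ⟨g, K, L, hK, hL, hg, hg0, hb, h⟩ := exists_rescaling_limit hf hk hkn hunb hshare
  exact false_of_iteratedDeriv_pow_omits_one hg hk hkn hK hL hb hg0 h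

/-- If `f` is nonconstant and `f'` is bounded on `{‖f‖ ≤ 1}`, then `f'` is controlled by `f`
everywhere. -/
theorem exists_norm_deriv_le_mul {f : ℂ → ℂ} (hf : Differentiable ℂ f) (hnc : ∃ z, deriv f z ≠ 0)
    {M : ℝ} (hM : ∀ w, ‖f w‖ ≤ 1 → ‖deriv f w‖ ≤ M) :
    ∃ L : ℝ, 0 < L ∧ ∀ w, ‖deriv f w‖ ≤ L * (1 + ‖f w‖) := by
  obtain ⟨x, hx⟩ : ∃ x, ‖f x‖ ≤ 1 := by
    by_contra! hcon
    have hne : ∀ z, f z ≠ 0 := fun z => norm_pos_iff.1 (one_pos.trans (hcon z))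
    have hconst := fun z => (hf.inv hne).apply_eq_apply_of_bounded
      (isBounded_iff_forall_norm_le.2 ⟨1, by
        rintro _ ⟨w, rfl⟩
        rw [Pi.inv_apply, norm_inv]
        exact inv_le_one_of_one_le₀ (hcon w).le⟩) z 0
    obtain ⟨z, hz⟩ := hnc
    refine hz ?_
    rw [show f = fun _ => f 0 from funext fun z => inv_injective (hconst z)]
    simp
  have hM0 : 0 ≤ M := (norm_nonneg _).trans (hM x hx)
  refine ⟨4 * (M + 1), by positivity, fun w => ?_⟩
  exact norm_deriv_le_mul_one_add_norm hf (ρ := ‖x - w‖) le_rfl hx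
    fun z _ hz => (hM z hz).trans (by linarith)

theorem one_add_norm_le_exp_mul {f : ℂ → ℂ} (hf : Differentiable ℂ f) {L : ℝ} (hL : 0 < L)
    (h : ∀ z, ‖deriv f z‖ ≤ L * (1 + ‖f z‖)) (w z : ℂ) :
    1 + ‖f z‖ ≤ (1 + ‖f w‖) * Real.exp (L * ‖z - w‖) :=
  one_add_norm_le_mul_exp hf hL (r := ‖z - w‖) (fun y _ => h y) le_rfl

/-- Polynomial bounds in terms of `f` pass to derivatives. -/
theorem exists_norm_deriv_le_mul_pow {f u : ℂ → ℂ} (hf : Differentiable ℂ f) {L : ℝ} (hL : 0 < L)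
    (h : ∀ z, ‖deriv f z‖ ≤ L * (1 + ‖f z‖)) (hu : Differentiable ℂ u) {C : ℝ} (hC : 0 ≤ C) {j : ℕ}
    (hb : ∀ z, ‖u z‖ ≤ C * (1 + ‖f z‖) ^ j) :
    ∃ C', 0 ≤ C' ∧ ∀ z, ‖deriv u z‖ ≤ C' * (1 + ‖f z‖) ^ j := by
  refine ⟨C * Real.exp L ^ j, by positivity, fun z => ?_⟩
  rw [mul_assoc, ← mul_pow, ← div_one (C * _)]
  refine Complex.norm_deriv_le_of_forall_mem_sphere_norm_le one_pos hu.diffContOnCl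
    fun y hy => (hb y).trans ?_
  have := one_add_norm_le_exp_mul hf hL h z y
  rw [mem_sphere, dist_eq_norm] at hy
  rw [hy, mul_one, mul_comm] at this
  gcongr

theorem exists_norm_powDerivCofactor_le {f : ℂ → ℂ} (hf : Differentiable ℂ f) {L : ℝ} (hL : 0 < L)
    (h : ∀ z, ‖deriv f z‖ ≤ L * (1 + ‖f z‖)) (n j : ℕ) :
    ∃ C, 0 ≤ C ∧ ∀ z, ‖powDerivCofactor f n j z‖ ≤ C * (1 + ‖f z‖) ^ j := by
  induction j with
  | zero => exact ⟨1, zero_le_one, by simp [powDerivCofactor]⟩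
  | succ j ih =>
    obtain ⟨C, hC, hb⟩ := ih
    obtain ⟨C', hC', hb'⟩ := exists_norm_deriv_le_mul_pow hf hL h
      (differentiable_powDerivCofactor hf n j) hC hb
    refine ⟨(n - j : ℕ) * L * C + C', by positivity, fun z => ?_⟩
    calc ‖powDerivCofactor f n (j + 1) z‖
        ≤ (n - j : ℕ) * ‖deriv f z‖ * ‖powDerivCofactor f n j z‖ +
          ‖f z‖ * ‖deriv (powDerivCofactor f n j) z‖ := by
          refine (norm_add_le _ _).trans ?_
          simp
      _ ≤ (n - j : ℕ) * (L * (1 + ‖f z‖)) * (C * (1 + ‖f z‖) ^ j) +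
          (1 + ‖f z‖) * (C' * (1 + ‖f z‖) ^ j) := by
          gcongr
          · exact h z
          · exact hb z
          · linarith
          · exact hb' z
      _ = _ := by ring

/-- The entire function `n f' f ^ (n - k - 1) (P - f ^ k)`, where `(f ^ n)⁽ᵏ⁾ = f ^ (n - k) P`, is
divisible by `f ^ n - 1` if `(f ^ n)⁽ᵏ⁾ = 1` wherever `f ^ n = 1`. -/
theorem exists_auxiliary_quotient {f : ℂ → ℂ} (hf : Differentiable ℂ f) {k n : ℕ}
    (hkn : k + 1 ≤ n) (hshare : ∀ z, f z ^ n = 1 → iteratedDeriv k (fun w => f w ^ n) z = 1)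
    {x : ℂ} (hx : f x ^ n ≠ 1) :
    ∃ φ : ℂ → ℂ, Differentiable ℂ φ ∧ ∀ z, n * deriv f z * f z ^ (n - k - 1) *
      (powDerivCofactor f n k z - f z ^ k) = φ z * (f z ^ n - 1) := by
  have hP := differentiable_powDerivCofactor hf n k
  have hN : Differentiable ℂ fun z => n * deriv f z * f z ^ (n - k - 1) *
      (powDerivCofactor f n k z - f z ^ k) :=
    ((hf.deriv.const_mul _).mul (hf.pow _)).mul (hP.sub (hf.pow k))
  have hE : Differentiable ℂ fun z => f z ^ n - 1 := (hf.pow n).sub_const 1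
  refine exists_eq_mul_of_analyticOrderAt_le hN hE (x₀ := x) (sub_ne_zero.2 hx) fun z hz => ?_
  have hz1 : f z ^ n = 1 := sub_eq_zero.1 hz
  have hfz : f z ≠ 0 := by
    intro h0
    rw [h0, zero_pow (by omega)] at hz1
    exact zero_ne_one hz1
  have hQz : powDerivCofactor f n k z - f z ^ k = 0 := by
    have h1 := hshare z hz1
    rw [iteratedDeriv_pow_eq_powDerivCofactor hf (by omega), ← hz1] at h1
    have h2 : f z ^ n = f z ^ (n - k) * f z ^ k := by rw [← pow_add, Nat.sub_add_cancel (by omega)]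
    rw [h2] at h1
    exact sub_eq_zero.2 (mul_left_cancel₀ (pow_ne_zero _ hfz) h1)
  have hQ : AnalyticAt ℂ (fun z => powDerivCofactor f n k z - f z ^ k) z :=
    (hP.sub (hf.pow k)).analyticAt z
  have hE' : AnalyticAt ℂ (deriv fun z => f z ^ n - 1) z := hE.deriv.analyticAt z
  have hfk : AnalyticAt ℂ (fun z => f z ^ k) z := (hf.pow k).analyticAt z
  have hder : deriv (fun z => f z ^ n - 1) = fun z => n * f z ^ (n - 1) * deriv f z := by
    funext y
    refine (((hf y).hasDerivAt.pow n).sub_const 1).deriv.trans ?_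
    rfl
  have hprod : (fun z => n * deriv f z * f z ^ (n - k - 1) *
      (powDerivCofactor f n k z - f z ^ k)) * (fun z => f z ^ k) =
      (deriv fun z => f z ^ n - 1) * fun z => powDerivCofactor f n k z - f z ^ k := by
    rw [hder]
    funext y
    simp only [Pi.mul_apply]
    rw [show n - 1 = (n - k - 1) + k by omega, pow_add]
    ring
  have h1 := congrArg (fun u => analyticOrderAt u z) hprod
  rw [analyticOrderAt_mul (hN.analyticAt z) hfk, analyticOrderAt_mul hE' hQ,
    hfk.analyticOrderAt_eq_zero.2 (pow_ne_zero k hfz), add_zero] at h1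
  rw [h1]
  have h2 := (hE.analyticAt z).analyticOrderAt_deriv_add_one
  simp only [hz, sub_zero] at h2
  rw [← h2]
  gcongr
  rw [Order.one_le_iff_ne_zero]
  exact hQ.analyticOrderAt_ne_zero.2 hQz

/-- Logarithmic derivative estimate at the centre of a disc on which `E` is small and zero-free. -/
theorem norm_deriv_le_of_zero_free {E : ℂ → ℂ} (hE : Differentiable ℂ E) {w z : ℂ} {D K : ℝ}
    (hD : 1 < D) (h0 : ∀ y ∈ ball w D, E y ≠ 0) (hlt : ∀ y ∈ ball w D, ‖E y‖ < 1 / 2)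
    (hz : dist z w = D - 1) (hK : ‖(E z)⁻¹‖ ≤ K) : ‖deriv E w‖ ≤ 2 * K * ‖E w‖ := by
  have hD0 : 0 < D := by linarith
  have hw : w ∈ ball w D := mem_ball_self hD0
  have hzm : z ∈ ball w D := by rw [mem_ball, hz]; linarith
  obtain ⟨h, hh, hEh⟩ := exists_log_on_ball (f := fun y => (2 * E y)⁻¹) (w := w) (d := D)
    (((hE.const_mul 2).differentiableOn).inv fun y hy => mul_ne_zero two_ne_zero (h0 y hy))
    (fun y hy => inv_ne_zero (mul_ne_zero two_ne_zero (h0 y hy)))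
  have hre : ∀ y ∈ ball w D, Real.exp (h y).re = (2 * ‖E y‖)⁻¹ := by
    intro y hy
    rw [← Complex.norm_exp, ← hEh y hy, norm_inv, norm_mul, Complex.norm_ofNat]
  have hpos : ∀ y ∈ ball w D, 0 < (h y).re := by
    intro y hy
    have h1 := hlt y hy
    have h2 := norm_pos_iff.2 (h0 y hy)
    rw [← Real.one_lt_exp_iff, hre y hy, one_lt_inv₀ (by positivity)]
    linarith
  have hder : deriv E w = -(E w * deriv h w) := by
    have e1 : E =ᶠ[𝓝 w] fun y => Complex.exp (-h y) / 2 := by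
      refine eventuallyEq_of_mem (isOpen_ball.mem_nhds hw) fun y hy => ?_
      have h1 := hEh y hy
      have h2 := h0 y hy
      rw [Complex.exp_neg, ← h1]
      field_simp
    have h2 := (hh.differentiableAt (isOpen_ball.mem_nhds hw)).hasDerivAt.neg.cexp.div_const 2
    rw [e1.deriv_eq]
    refine h2.deriv.trans ?_
    rw [e1.self_of_nhds]
    simp only [Pi.neg_apply]
    ring
  have h1 := norm_deriv_le_of_re_pos hD0 hh hpos
  have h2 := harnack_re hh hpos hzm
  rw [hz] at h2
  have h3 := Real.add_one_le_exp (h z).re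
  rw [hre z hzm, mul_inv, ← norm_inv] at h3
  have h4 := hpos z hzm
  have h5 : ‖deriv h w‖ ≤ 2 * K := by
    refine le_of_mul_le_mul_right ?_ hD0
    nlinarith
  rw [hder, norm_neg, norm_mul, mul_comm]
  gcongr

theorem norm_iteratedDeriv_lt_one_of_norm_lt_half {E : ℂ → ℂ} (hE : Differentiable ℂ E) {k : ℕ}
    (hk : 1 ≤ k) {w : ℂ} {d : ℝ} (hlt : ∀ y ∈ ball w d, ‖E y‖ < 1 / 2) {y : ℂ}
    (hy : y ∈ ball w (d - k)) :
    ‖iteratedDeriv k E y‖ < 1 := by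
  have hk0 : (0 : ℝ) < k := Nat.cast_pos.2 hk
  have h1 := Complex.norm_iteratedDeriv_le_of_forall_mem_sphere_norm_le (c := y) (R := k)
    (C := 1 / 2) k hk0 hE.diffContOnCl (fun z hz => (hlt z (by
      rw [mem_ball] at hy ⊢
      rw [mem_sphere] at hz
      have := dist_triangle z y w
      linarith)).le)
  refine h1.trans_lt ?_
  rw [div_lt_one (by positivity)]
  have : (k.factorial : ℝ) ≤ (k : ℝ) ^ k := by exact_mod_cast Nat.factorial_le_pow k
  have h2 : (0 : ℝ) < (k : ℝ) ^ k := by positivity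
  linarith

/-- The auxiliary quotient is bounded. -/
theorem exists_norm_auxiliary_quotient_le {f : ℂ → ℂ} (hf : Differentiable ℂ f)
    (hnc : ∃ z, deriv f z ≠ 0) {L : ℝ} (hL : 0 < L)
    (h : ∀ z, ‖deriv f z‖ ≤ L * (1 + ‖f z‖)) {k n : ℕ} (hk : 1 ≤ k) (hkn : k + 1 ≤ n)
    (hshare : ∀ z, f z ^ n = 1 → iteratedDeriv k (fun w => f w ^ n) z = 1) {φ : ℂ → ℂ}
    (hφ : Differentiable ℂ φ) (hφE : ∀ z, n * deriv f z * f z ^ (n - k - 1) *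
      (powDerivCofactor f n k z - f z ^ k) = φ z * (f z ^ n - 1)) :
    ∃ C : ℝ, ∀ w, ‖φ w‖ ≤ C := by
  have hE : Differentiable ℂ fun z => f z ^ n - 1 := (hf.pow n).sub_const 1
  obtain ⟨CP, hCP, hP⟩ := exists_norm_powDerivCofactor_le hf hL h n k
  have hQ : ∀ z, ‖powDerivCofactor f n k z - f z ^ k‖ ≤ (CP + 1) * (1 + ‖f z‖) ^ k := by
    intro z
    have h1 : ‖f z ^ k‖ ≤ (1 + ‖f z‖) ^ k := by
      rw [norm_pow]
      gcongr
      linarith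
    have := norm_sub_le (powDerivCofactor f n k z) (f z ^ k)
    have := hP z
    linarith
  set CN : ℝ := n * L * (CP + 1) with hCN
  have hCN0 : 0 ≤ CN := by positivity
  have hN : ∀ z, ‖φ z * (f z ^ n - 1)‖ ≤ CN * (1 + ‖f z‖) ^ n := by
    intro z
    rw [← hφE, norm_mul, norm_mul, norm_mul, norm_pow, Complex.norm_natCast]
    calc n * ‖deriv f z‖ * ‖f z‖ ^ (n - k - 1) * ‖powDerivCofactor f n k z - f z ^ k‖
        ≤ n * (L * (1 + ‖f z‖)) * (1 + ‖f z‖) ^ (n - k - 1) *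
          ((CP + 1) * (1 + ‖f z‖) ^ k) := by
          gcongr
          · exact h z
          · linarith
          · exact hQ z
      _ = CN * ((1 + ‖f z‖) ^ 1 * (1 + ‖f z‖) ^ (n - k - 1) * (1 + ‖f z‖) ^ k) := by
          rw [hCN]; ring
      _ = _ := by
          rw [← pow_add, ← pow_add, show 1 + (n - k - 1) + k = n by omega]
  set R : ℝ := 2 * k + 2 with hR
  set T : ℝ := 3 * Real.exp (L * (R + 1)) with hT
  have hT1 : 1 ≤ T := by
    have : 1 ≤ Real.exp (L * (R + 1)) := Real.one_le_exp (by positivity)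
    linarith
  have hfT : ∀ w z, ‖f w‖ ≤ 2 → ‖z - w‖ < R + 1 → 1 + ‖f z‖ ≤ T := by
    intro w z hw hz
    refine (one_add_norm_le_exp_mul hf hL h w z).trans ?_
    rw [hT]
    gcongr
    linarith
  set B : ℝ := (CN + 2) * T ^ n with hB
  have hTn : 1 ≤ T ^ n := one_le_pow₀ hT1
  have hEB : ∀ z, 1 + ‖f z‖ ≤ T → ‖f z ^ n - 1‖ ≤ B := by
    intro z hz
    refine (norm_sub_le _ _).trans ?_
    rw [norm_one, norm_pow]
    have : ‖f z‖ ^ n ≤ T ^ n := pow_le_pow_left₀ (norm_nonneg _) (by linarith) n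
    nlinarith
  have hNB : ∀ z, 1 + ‖f z‖ ≤ T → ‖φ z * (f z ^ n - 1)‖ ≤ B := by
    intro z hz
    refine (hN z).trans ?_
    have : (1 + ‖f z‖) ^ n ≤ T ^ n := pow_le_pow_left₀ (by positivity) hz n
    nlinarith
  obtain ⟨K₁, hK₁⟩ := exists_bound_of_mul_bound_at (R := R) (B := B) (by positivity)
    (half_pos one_pos)
  obtain ⟨K₂, hK₂⟩ := exists_bound_of_mul_bound_at (R := (k : ℝ) + 1) (B := B) (by positivity)
    (half_pos one_pos)
  have hbig : ∀ w, 2 ≤ ‖f w‖ → ‖φ w‖ ≤ 2 * CN * 2 ^ n := by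
    intro w hw
    have h1 : 2 ≤ ‖f w‖ ^ n := hw.trans (le_self_pow₀ (by linarith) (by omega))
    have h2 : ‖f w‖ ^ n / 2 ≤ ‖f w ^ n - 1‖ := by
      have := norm_sub_norm_le (f w ^ n) 1
      rw [norm_pow, norm_one] at this
      linarith
    have h3 := hN w
    rw [norm_mul] at h3
    have h4 : (1 + ‖f w‖) ^ n ≤ 2 ^ n * ‖f w‖ ^ n := by
      rw [← mul_pow]
      gcongr
      linarith
    refine le_of_mul_le_mul_right ?_ (by linarith : 0 < ‖f w‖ ^ n / 2)
    calc ‖φ w‖ * (‖f w‖ ^ n / 2) ≤ ‖φ w‖ * ‖f w ^ n - 1‖ := by gcongr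
      _ ≤ CN * (2 ^ n * ‖f w‖ ^ n) := h3.trans (by gcongr)
      _ = _ := by ring
  have hsmallE : ∀ z, ‖f z ^ n - 1‖ < 1 / 2 → ‖f z‖ ≤ 2 := by
    intro z hz
    by_contra! h1
    have h2 : 2 ≤ ‖f z‖ ^ n := h1.le.trans (le_self_pow₀ (by linarith) (by omega))
    have := norm_sub_norm_le (f z ^ n) 1
    rw [norm_pow, norm_one] at this
    linarith
  obtain ⟨x, hx⟩ : ∃ x, 1 / 2 ≤ ‖f x ^ n - 1‖ := by
    by_contra! hcon
    obtain ⟨z, hz⟩ := hnc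
    have hconst := fun z => hf.apply_eq_apply_of_bounded
      (isBounded_iff_forall_norm_le.2 ⟨2, by rintro _ ⟨w, rfl⟩; exact hsmallE w (hcon w)⟩) z 0
    rw [show f = fun _ => f 0 from funext hconst] at hz
    simp at hz
  have hclosed : IsClosed {z | 1 / 2 ≤ ‖f z ^ n - 1‖} :=
    isClosed_le continuous_const hE.continuous.norm
  have hfar : ∀ w, ‖f w‖ ≤ 2 → (∀ z, ‖z - w‖ ≤ R → ‖f z ^ n - 1‖ < 1 / 2) →
      ‖φ w‖ ≤ 2 * K₂ * ((CP + 1) * 3 ^ k * 2) := by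
    intro w hw hwR
    obtain ⟨z₁, hz₁, hdist⟩ := hclosed.exists_infDist_eq_dist ⟨x, hx⟩ w
    set d := dist w z₁ with hd
    have hRd : R < d := by
      by_contra! hle
      rw [hd, dist_comm, dist_eq_norm] at hle
      exact absurd hz₁ (not_le.2 (hwR z₁ hle))
    have hlt : ∀ y ∈ ball w d, ‖f y ^ n - 1‖ < 1 / 2 := by
      intro y hy
      by_contra! hy1
      have h1 : infDist w {z | 1 / 2 ≤ ‖f z ^ n - 1‖} ≤ dist w y := infDist_le_dist_of_mem hy1
      rw [hdist, dist_comm w y] at h1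
      exact absurd hy (not_lt.2 h1)
    have hk0 : (0 : ℝ) ≤ k := k.cast_nonneg
    have hsub : ball w (d - k) ⊆ ball w d := ball_subset_ball (by linarith)
    have hzf : ∀ y ∈ ball w (d - k), f y ^ n - 1 ≠ 0 := by
      intro y hy h0
      have h1 := norm_iteratedDeriv_lt_one_of_norm_lt_half hE hk hlt hy
      have h2 : iteratedDeriv k (fun z => f z ^ n - 1) y = 1 := by
        have := iteratedDeriv_sub (n := k) (x := y) (hf.pow n).contDiff.contDiffAt
          (contDiff_const (c := (1 : ℂ))).contDiffAt
        rw [iteratedDeriv_const, if_neg (by omega), sub_zero] at this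
        exact this.trans (hshare y (sub_eq_zero.1 h0))
      rw [h2, norm_one] at h1
      exact lt_irrefl _ h1
    have hd0 : 0 < d := by linarith [show (0 : ℝ) < R by positivity]
    set z₂ : ℂ := w + ((d - k - 1) / d : ℝ) * (z₁ - w) with hz₂
    have hz₁w : ‖z₁ - w‖ = d := by rw [hd, dist_comm, dist_eq_norm]
    have hz₂w : dist z₂ w = (d - k) - 1 := by
      rw [hz₂, dist_eq_norm, add_sub_cancel_left, norm_mul, Complex.norm_real, hz₁w,
        Real.norm_of_nonneg (div_nonneg (by linarith) hd0.le), div_mul_cancel₀ _ hd0.ne']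
    have hz₁z₂ : ‖z₁ - z₂‖ ≤ (k : ℝ) + 1 := by
      have h1 : z₁ - z₂ = ((k + 1) / d : ℝ) * (z₁ - w) := by
        have : (d : ℂ) ≠ 0 := Complex.ofReal_ne_zero.2 hd0.ne'
        rw [hz₂]
        push_cast
        field_simp
        ring
      rw [h1, norm_mul, Complex.norm_real, hz₁w,
        Real.norm_of_nonneg (div_nonneg (by linarith) hd0.le), div_mul_cancel₀ _ hd0.ne']
    have hball : ball z₂ 1 ⊆ ball w (d - k) := ball_subset_ball' (by rw [hz₂w]; linarith)
    have hf2 : ‖f z₂‖ ≤ 2 := hsmallE z₂ (hlt z₂ (hsub (hball (mem_ball_self one_pos))))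
    have hinv := hK₂ z₂ _ hE (fun z hz => hEB z (hfT z₂ z hf2 (by linarith)))
      ⟨z₁, hz₁z₂, hz₁⟩ (fun z => (f z ^ n - 1)⁻¹)
      (hE.differentiableOn.inv fun y hy => hzf y (hball hy))
      (fun z hz => by
        rw [inv_mul_cancel₀ (hzf z (hball hz)), norm_one, hB]
        nlinarith)
    have hlog := norm_deriv_le_of_zero_free hE (by linarith) hzf
      (fun y hy => hlt y (hsub hy)) hz₂w hinv
    have hwm : w ∈ ball w (d - k) := mem_ball_self (by linarith)
    have hEw := norm_pos_iff.2 (hzf w hwm)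
    have hwhalf := hlt w (hsub hwm)
    have hfn : 1 / 2 ≤ ‖f w‖ ^ n := by
      have := norm_sub_norm_le 1 (f w ^ n)
      rw [norm_sub_rev, norm_one, norm_pow] at this
      linarith
    have hfk : 1 / 2 ≤ ‖f w‖ ^ k := by
      rcases le_total ‖f w‖ 1 with h1 | h1
      · exact hfn.trans (pow_le_pow_of_le_one (norm_nonneg _) h1 (by omega))
      · linarith [one_le_pow₀ h1 (n := k)]
    have hder : deriv (fun z => f z ^ n - 1) w = n * f w ^ (n - 1) * deriv f w :=
      (((hf w).hasDerivAt.pow n).sub_const 1).deriv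
    have hkey : φ w * (f w ^ n - 1) * f w ^ k = deriv (fun z => f z ^ n - 1) w *
        (powDerivCofactor f n k w - f w ^ k) := by
      rw [← hφE, hder, show n - 1 = (n - k - 1) + k by omega, pow_add]
      ring
    have hkey' := congrArg norm hkey
    rw [norm_mul, norm_mul, norm_mul, norm_pow] at hkey'
    have hQw : ‖powDerivCofactor f n k w - f w ^ k‖ ≤ (CP + 1) * 3 ^ k := by
      refine (hQ w).trans ?_
      gcongr
      linarith
    have hK0 : 0 ≤ K₂ := (norm_nonneg _).trans hinv
    have h1 : ‖φ w‖ * ‖f w ^ n - 1‖ * (1 / 2) ≤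
        2 * K₂ * ‖f w ^ n - 1‖ * ((CP + 1) * 3 ^ k) :=
      calc ‖φ w‖ * ‖f w ^ n - 1‖ * (1 / 2) ≤ ‖φ w‖ * ‖f w ^ n - 1‖ * ‖f w‖ ^ k := by gcongr
        _ ≤ _ := by rw [hkey']; gcongr
    refine le_of_mul_le_mul_right ?_ hEw
    linarith
  refine ⟨max (2 * CN * 2 ^ n) (max K₁ (2 * K₂ * ((CP + 1) * 3 ^ k * 2))), fun w => ?_⟩
  rcases le_total 2 ‖f w‖ with hw | hw
  · exact le_max_of_le_left (hbig w hw)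
  refine le_max_of_le_right ?_
  by_cases hex : ∃ z, ‖z - w‖ ≤ R ∧ 1 / 2 ≤ ‖f z ^ n - 1‖
  · refine le_max_of_le_left (hK₁ w _ hE (fun z hz => hEB z (hfT w z hw hz)) hex φ
      hφ.differentiableOn fun z hz => hNB z (hfT w z hw ?_))
    rw [mem_ball, dist_eq_norm] at hz
    linarith [show (0 : ℝ) < R by positivity]
  · push Not at hex
    exact le_max_of_le_right (hfar w hw hex)

theorem iteratedDeriv_one_pow {f : ℂ → ℂ} (hf : Differentiable ℂ f) (n : ℕ) (z : ℂ) :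
    iteratedDeriv 1 (fun w => f w ^ n) z = n * f z ^ (n - 1) * deriv f z := by
  rw [iteratedDeriv_one]
  exact ((hf z).hasDerivAt.pow n).deriv

/-- The auxiliary equation as a differential equation for `f ^ n`. -/
theorem deriv_pow_mul_sub_eq {f : ℂ → ℂ} (hf : Differentiable ℂ f) {k n : ℕ} (hkn : k + 1 ≤ n)
    {c : ℂ} (h : ∀ z, n * deriv f z * f z ^ (n - k - 1) *
      (powDerivCofactor f n k z - f z ^ k) = c * (f z ^ n - 1)) (z : ℂ) :
    iteratedDeriv 1 (fun w => f w ^ n) z * (iteratedDeriv k (fun w => f w ^ n) z - f z ^ n) =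
      c * f z ^ n * (f z ^ n - 1) := by
  obtain ⟨m, rfl⟩ := Nat.exists_eq_add_of_le hkn
  have h1 := h z
  rw [iteratedDeriv_one_pow hf,
    iteratedDeriv_pow_eq_powDerivCofactor hf (by omega)]
  rw [show k + 1 + m - k - 1 = m by omega] at h1
  rw [show k + 1 + m - k = m + 1 by omega, show k + 1 + m - 1 = k + m by omega]
  linear_combination f z ^ (k + 1 + m) * h1

/-- Conclusion when `f ^ n` equals its `k`-th derivative. -/
theorem exists_eq_mul_exp_of_iteratedDeriv_pow_eq {f : ℂ → ℂ} (hf : Differentiable ℂ f)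
    {K L : ℝ} (hK : 0 < K) (hL : 0 ≤ L) (hb : ∀ z, ‖f z‖ ≤ K * Real.exp (L * ‖z‖))
    (hnc : ∃ z, deriv f z ≠ 0) {k n : ℕ} (hk : 1 ≤ k) (hkn : k + 1 ≤ n)
    (h : ∀ z, iteratedDeriv k (fun w => f w ^ n) z = f z ^ n) :
    ∃ c l : ℂ, c ≠ 0 ∧ l ≠ 0 ∧ l ^ k = 1 ∧ ∀ z, f z = c * Complex.exp (l / (n : ℂ) * z) := by
  have hn0 : (n : ℂ) ≠ 0 := Nat.cast_ne_zero.2 (by omega)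
  have hzero : ∀ z, f z ≠ 0 := by
    intro z hz
    have hF := eq_zero_of_iteratedDeriv_eq_mul (u := fun w => f w ^ n) (a := 1) (z₀ := z)
      (hf.pow n) hk (fun y => by rw [h, one_mul])
      (fun i hi => iteratedDeriv_pow_eq_zero hf (by omega) hz)
    obtain ⟨x, hx⟩ := hnc
    rw [show f = fun _ => 0 from funext fun y => eq_zero_of_pow_eq_zero (hF y)] at hx
    simp at hx
  obtain ⟨a, b, hab⟩ := exists_eq_exp_affine hf hzero hK hL hb
  have hak : (n * a) ^ k = 1 := by
    have h0 := h 0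
    rw [show (fun w => f w ^ n) = fun w => Complex.exp (n * a * w + n * b) from
      funext fun w => by rw [hab, exp_affine_pow], iteratedDeriv_exp_affine, hab,
      exp_affine_pow] at h0
    exact mul_right_cancel₀ (Complex.exp_ne_zero _) (h0.trans (one_mul _).symm)
  refine ⟨Complex.exp b, n * a, Complex.exp_ne_zero b, ?_, hak, fun z => ?_⟩
  · intro h0
    rw [h0, zero_pow (by omega)] at hak
    exact zero_ne_one hak
  · rw [hab, mul_div_cancel_left₀ _ hn0, Complex.exp_add, mul_comm]

theorem exists_eq_zero_of_auxiliary_eq {f : ℂ → ℂ} (hf : Differentiable ℂ f)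
    {K L : ℝ} (hK : 0 < K) (hL : 0 ≤ L) (hb : ∀ z, ‖f z‖ ≤ K * Real.exp (L * ‖z‖))
    (hnc : ∃ z, deriv f z ≠ 0) {k n : ℕ} (hn : 1 ≤ n) {c : ℂ} (hc : c ≠ 0)
    (h : ∀ z, iteratedDeriv 1 (fun w => f w ^ n) z *
      (iteratedDeriv k (fun w => f w ^ n) z - f z ^ n) = c * f z ^ n * (f z ^ n - 1)) :
    ∃ z, f z = 0 := by
  by_contra! hzero
  have hn0 : (n : ℂ) ≠ 0 := Nat.cast_ne_zero.2 (by omega)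
  obtain ⟨a, b, hab⟩ := exists_eq_exp_affine hf hzero hK hL hb
  have ha : a ≠ 0 := by
    rintro rfl
    obtain ⟨x, hx⟩ := hnc
    rw [show f = fun _ => Complex.exp b from funext fun z => by rw [hab]; simp] at hx
    simp at hx
  have hy : ∀ y : ℂ, y ≠ 0 → n * a * ((n * a) ^ k - 1) * y = c * (y - 1) := by
    intro y hy
    obtain ⟨z, hz⟩ := exists_exp_affine_eq (b := n * b) (mul_ne_zero hn0 ha) hy
    have h1 := h z
    rw [show (fun w => f w ^ n) = fun w => Complex.exp (n * a * w + n * b) from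
      funext fun w => by rw [hab, exp_affine_pow], iteratedDeriv_exp_affine,
      iteratedDeriv_exp_affine, hab, exp_affine_pow] at h1
    simp only [hz] at h1
    refine mul_left_cancel₀ hy ?_
    linear_combination h1
  have h1 := hy 1 one_ne_zero
  have h2 := hy 2 two_ne_zero
  exact hc (by linear_combination 2 * h1 - h2)

/-- Values of the cofactors and of their derivatives at the zeros of `f`. -/
theorem exists_powDerivCofactor_eq_of_eq_zero {f : ℂ → ℂ} (hf : Differentiable ℂ f) {n j : ℕ}
    (hj : j ≤ n) : ∃ p q : ℕ, 0 < p ∧ ∀ z, f z = 0 →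
      powDerivCofactor f n j z = p * deriv f z ^ j ∧
      deriv (powDerivCofactor f n j) z * deriv f z =
        q * deriv (deriv f) z * deriv f z ^ j := by
  induction j with
  | zero => exact ⟨1, 0, one_pos, fun z _ => by simp [powDerivCofactor]⟩
  | succ j ih =>
    obtain ⟨p, q, hp, h⟩ := ih (by omega)
    refine ⟨(n - j) * p, (n - j) * p + (n - j + 1) * q, by
      have : 0 < n - j := by omega
      positivity, fun z hz => ?_⟩
    obtain ⟨h1, h2⟩ := h z hz
    have hP := differentiable_powDerivCofactor hf n j
    have hd : deriv (powDerivCofactor f n (j + 1)) z =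
        (n - j : ℕ) * (deriv (deriv f) z * powDerivCofactor f n j z +
          deriv f z * deriv (powDerivCofactor f n j) z) +
        (deriv f z * deriv (powDerivCofactor f n j) z +
          f z * deriv (deriv (powDerivCofactor f n j)) z) := by
      have e := (((hf.deriv z).hasDerivAt.const_mul ((n - j : ℕ) : ℂ)).mul
        (hP z).hasDerivAt).add ((hf z).hasDerivAt.mul (hP.deriv z).hasDerivAt)
      refine e.deriv.trans ?_
      ring
    constructor
    · simp only [powDerivCofactor, hz, h1]
      push_cast
      ring
    · rw [hd, hz, h1]
      push_cast
      linear_combination ((n - j : ℕ) + 1 : ℂ) * deriv f z * h2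

/-- If `f'` is controlled by `f` and `f` is nowhere uniformly small, then `f` solves a linear
equation `f'' = b f' + a f` as soon as this is consistent at the zeros of `f`. -/
theorem exists_deriv_deriv_eq {f : ℂ → ℂ} (hf : Differentiable ℂ f) {L : ℝ} (hL : 0 < L)
    (h : ∀ z, ‖deriv f z‖ ≤ L * (1 + ‖f z‖)) {b : ℂ} (hs : ∀ z, f z = 0 → deriv f z ≠ 0)
    (hb : ∀ z, f z = 0 → deriv (deriv f) z = b * deriv f z) {ε : ℝ} (hε : 0 < ε)
    (hlarge : ∀ w, ∃ z, ‖z - w‖ ≤ 1 ∧ ε ≤ ‖f z‖) :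
    ∃ a, ∀ z, deriv (deriv f) z = b * deriv f z + a * f z := by
  have hN : Differentiable ℂ fun z => deriv (deriv f) z - b * deriv f z :=
    hf.deriv.deriv.sub (hf.deriv.const_mul b)
  obtain ⟨x, -, hx⟩ := hlarge 0
  obtain ⟨φ, hφ, hφN⟩ := exists_eq_mul_of_analyticOrderAt_le hN hf
    (norm_pos_iff.1 (hε.trans_le hx)) (by
      intro z hz
      have h1 := (hf.analyticAt z).analyticOrderAt_deriv_add_one
      simp only [hz, sub_zero] at h1
      rw [(hf.deriv.analyticAt z).analyticOrderAt_eq_zero.2 (hs z hz), zero_add] at h1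
      rw [← h1, Order.one_le_iff_ne_zero]
      refine (hN.analyticAt z).analyticOrderAt_ne_zero.2 ?_
      rw [hb z hz, sub_self])
  obtain ⟨C, hC, hC'⟩ := exists_norm_deriv_le_mul_pow hf hL h hf.deriv hL.le (j := 1)
    (by simpa using h)
  simp only [pow_one] at hC'
  set D : ℝ := C + ‖b‖ * L with hD
  have hD0 : 0 ≤ D := by positivity
  have hND : ∀ z, ‖φ z * f z‖ ≤ D * (1 + ‖f z‖) := by
    intro z
    rw [← hφN]
    refine (norm_sub_le _ _).trans ?_
    rw [norm_mul]
    have := mul_le_mul_of_nonneg_left (h z) (norm_nonneg b)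
    have := hC' z
    rw [hD]
    linarith
  set T : ℝ := 2 * Real.exp (L * 2) with hT
  have hT0 : 0 < T := by positivity
  have hfT : ∀ w z, ‖f w‖ ≤ 1 → ‖z - w‖ < 1 + 1 → 1 + ‖f z‖ ≤ T := by
    intro w z hw hz
    refine (one_add_norm_le_exp_mul hf hL h w z).trans ?_
    rw [hT]
    gcongr <;> linarith
  obtain ⟨K, hK⟩ := exists_bound_of_mul_bound_at (R := 1) (B := (D + 1) * T) zero_le_one hε
  have hbound : ∀ w, ‖φ w‖ ≤ max (2 * D) K := by
    intro w
    rcases le_total 1 ‖f w‖ with hw | hw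
    · refine le_max_of_le_left ?_
      have h1 := hND w
      rw [norm_mul] at h1
      refine le_of_mul_le_mul_right ?_ (by linarith : 0 < ‖f w‖)
      nlinarith
    · refine le_max_of_le_right (hK w f hf (fun z hz => ?_) (hlarge w) φ hφ.differentiableOn
        fun z hz => ?_)
      · have := hfT w z hw hz
        nlinarith
      · rw [mem_ball, dist_eq_norm] at hz
        have := hfT w z hw (by linarith)
        refine (hND z).trans ?_
        gcongr
        linarith
  refine ⟨φ 0, fun z => ?_⟩
  have hconst := hφ.apply_eq_apply_of_bounded
    (isBounded_iff_forall_norm_le.2 ⟨_, by rintro _ ⟨w, rfl⟩; exact hbound w⟩) z 0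
  rw [← hconst]
  linear_combination hφN z

/-- Solutions of `u'' = a u` are odd about their zeros. -/
theorem apply_sub_eq_neg_of_deriv_deriv_eq {u : ℂ → ℂ} (hu : Differentiable ℂ u) {a : ℂ}
    (h : ∀ z, deriv (deriv u) z = a * u z) {z₀ : ℂ} (h0 : u z₀ = 0) (z : ℂ) :
    u (z₀ - z) = -u (z₀ + z) := by
  have hd1 : deriv (fun z => u (z₀ + z) + u (z₀ - z)) =
      fun z => deriv u (z₀ + z) - deriv u (z₀ - z) := by
    funext y
    have e1 := (hu (z₀ + y)).hasDerivAt.comp_const_add z₀ y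
    have e2 := (hu (z₀ - y)).hasDerivAt.comp_const_sub z₀ y
    exact (e1.add e2).deriv
  have hd2 : deriv (fun z => deriv u (z₀ + z) - deriv u (z₀ - z)) =
      fun z => deriv (deriv u) (z₀ + z) + deriv (deriv u) (z₀ - z) := by
    funext y
    have e1 := (hu.deriv (z₀ + y)).hasDerivAt.comp_const_add z₀ y
    have e2 := (hu.deriv (z₀ - y)).hasDerivAt.comp_const_sub z₀ y
    refine (e1.sub e2).deriv.trans ?_
    ring
  have hdu : Differentiable ℂ fun z => u (z₀ + z) + u (z₀ - z) :=
    (hu.comp (differentiable_id.const_add z₀)).add (hu.comp (differentiable_id.const_sub z₀))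
  have := eq_zero_of_iteratedDeriv_eq_mul (a := a) (z₀ := 0) hdu one_le_two (fun y => by
    rw [show 2 = 1 + 1 from rfl, iteratedDeriv_succ, iteratedDeriv_one, hd1, hd2]
    simp only [h]
    ring) (fun i hi => by
    interval_cases i
    · simp [h0]
    · rw [iteratedDeriv_one, hd1]
      simp) z
  exact eq_neg_of_add_eq_zero_right this

theorem exists_le_norm_of_auxiliary_eq {f : ℂ → ℂ} (hf : Differentiable ℂ f) {L : ℝ} (hL : 0 < L)
    (h : ∀ z, ‖deriv f z‖ ≤ L * (1 + ‖f z‖)) {k n : ℕ} (hn : 1 ≤ n) {c : ℂ} (hc : c ≠ 0)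
    (heq : ∀ z, n * deriv f z * (powDerivCofactor f n k z - f z ^ k) = c * (f z ^ n - 1)) :
    ∃ ε : ℝ, 0 < ε ∧ ∀ w, ∃ z, ‖z - w‖ ≤ 1 ∧ ε ≤ ‖f z‖ := by
  obtain ⟨C, hC, hP⟩ := exists_norm_powDerivCofactor_le hf hL h n k
  have hn0 : (0 : ℝ) < n := Nat.cast_pos.2 hn
  set M : ℝ := n * (C * 2 ^ k + 1) with hM
  have hM0 : 0 < M := by positivity
  have hc0 := norm_pos_iff.2 hc
  refine ⟨min (1 / 2) (‖c‖ / (4 * M)), by positivity, fun w => ?_⟩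
  by_contra! hcon
  have hf1 : ‖f w‖ < 1 / 2 := (hcon w (by simp)).trans_le (min_le_left _ _)
  have hd : ‖deriv f w‖ ≤ ‖c‖ / (4 * M) := by
    rw [← div_one (‖c‖ / (4 * M))]
    refine Complex.norm_deriv_le_of_forall_mem_sphere_norm_le one_pos hf.diffContOnCl fun y hy => ?_
    rw [mem_sphere, dist_eq_norm] at hy
    exact (hcon y hy.le).le.trans (min_le_right _ _)
  have hQ : ‖powDerivCofactor f n k w - f w ^ k‖ ≤ C * 2 ^ k + 1 := by
    refine (norm_sub_le _ _).trans (add_le_add ((hP w).trans ?_) ?_)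
    · gcongr
      linarith
    · rw [norm_pow]
      exact pow_le_one₀ (norm_nonneg _) (by linarith)
  have hE : 1 / 2 ≤ ‖f w ^ n - 1‖ := by
    have h1 := norm_sub_norm_le 1 (f w ^ n)
    rw [norm_sub_rev, norm_one, norm_pow] at h1
    have h2 := pow_le_of_le_one (norm_nonneg (f w)) (by linarith) (n := n) (by omega)
    linarith
  have h1 := congrArg norm (heq w)
  rw [norm_mul, norm_mul, norm_mul, Complex.norm_natCast] at h1
  have h2 : n * ‖deriv f w‖ * ‖powDerivCofactor f n k w - f w ^ k‖ ≤ ‖c‖ / 4 :=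
    calc n * ‖deriv f w‖ * ‖powDerivCofactor f n k w - f w ^ k‖
        ≤ n * (‖c‖ / (4 * M)) * (C * 2 ^ k + 1) := by gcongr
      _ = ‖c‖ / (4 * M) * M := by rw [hM]; ring
      _ = ‖c‖ / 4 := by field_simp
  nlinarith

/-- At the zeros of `f` the auxiliary equation with `n = k + 1` determines `f''`. -/
theorem deriv_deriv_eq_of_auxiliary_eq {f : ℂ → ℂ} (hf : Differentiable ℂ f) {k : ℕ} (hk : 1 ≤ k)
    {c : ℂ} (heq : ∀ z, ((k + 1 : ℕ) : ℂ) * deriv f z *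
      (powDerivCofactor f (k + 1) k z - f z ^ k) = c * (f z ^ (k + 1) - 1))
    {z : ℂ} (hz : f z = 0) (hs : deriv f z ≠ 0) :
    deriv (deriv f) z = (if k = 1 then 1 / 4 else 0) * deriv f z := by
  have hP := differentiable_powDerivCofactor hf (k + 1) k
  have e1 := (((hf.deriv z).hasDerivAt.const_mul ((k + 1 : ℕ) : ℂ)).mul
    ((hP z).hasDerivAt.sub ((hf z).hasDerivAt.pow k))).deriv
  have e2 := ((((hf z).hasDerivAt.pow (k + 1)).sub_const 1).const_mul c).deriv
  have e3 := e1.symm.trans ((congrArg (fun u => deriv u z) (funext heq)).trans e2)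
  have hk0 : ((k + 1 : ℕ) : ℂ) ≠ 0 := Nat.cast_ne_zero.2 (by omega)
  simp only [Pi.sub_apply, Pi.pow_apply, hz, Nat.add_sub_cancel, zero_pow (by omega : k ≠ 0)] at e3
  have e4 : deriv (deriv f) z * powDerivCofactor f (k + 1) k z +
      deriv f z * deriv (powDerivCofactor f (k + 1) k) z =
      k * 0 ^ (k - 1) * deriv f z ^ 2 := by
    refine mul_left_cancel₀ hk0 ?_
    linear_combination e3
  split_ifs with h1
  · subst h1
    obtain ⟨p, q, hp, hpq⟩ := exists_powDerivCofactor_eq_of_eq_zero hf (n := 2) (j := 1) (by omega)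
    have h2 : powDerivCofactor f (1 + 1) 1 = fun z => 2 * deriv f z := by
      funext y
      simp [powDerivCofactor]
    rw [h2, deriv_const_mul _ (hf.deriv z)] at e4
    refine mul_left_cancel₀ hs ?_
    simp at e4
    linear_combination e4 / 4
  · obtain ⟨p, q, hp, hpq⟩ := exists_powDerivCofactor_eq_of_eq_zero hf (n := k + 1) (j := k)
      (by omega)
    obtain ⟨h2, h3⟩ := hpq z hz
    rw [zero_pow (by omega), h2] at e4
    have h4 : (p + q : ℂ) * deriv f z ^ k * deriv (deriv f) z = 0 := by
      linear_combination e4 - h3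
    rw [zero_mul]
    refine (mul_eq_zero.1 h4).resolve_left (mul_ne_zero ?_ (pow_ne_zero k hs))
    exact_mod_cast (by omega : p + q ≠ 0)

/-- The auxiliary equation with `n = k + 1` has no solution that is odd about a simple zero. -/
theorem false_of_odd {f : ℂ → ℂ} (hf : Differentiable ℂ f) {k : ℕ} {c : ℂ} (hc : c ≠ 0)
    (heq : ∀ z, iteratedDeriv 1 (fun w => f w ^ (k + 1)) z *
      (iteratedDeriv k (fun w => f w ^ (k + 1)) z - f z ^ (k + 1)) =
      c * f z ^ (k + 1) * (f z ^ (k + 1) - 1)) {z₀ : ℂ} (h0 : f z₀ = 0) (hs : deriv f z₀ ≠ 0)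
    (hodd : ∀ z, f (z₀ - z) = -f (z₀ + z)) : False := by
  set F : ℂ → ℂ := fun w => f w ^ (k + 1) with hF
  have hpar : (fun z => F (z₀ - z)) = fun z => (-1) ^ (k + 1) * F (z₀ + z) := by
    funext z
    rw [hF]
    simp only [hodd]
    rw [neg_pow]
  have hder : ∀ j z, (-1) ^ j * iteratedDeriv j F (z₀ - z) =
      (-1) ^ (k + 1) * iteratedDeriv j F (z₀ + z) := by
    intro j z
    have h1 := congrFun (congrArg (iteratedDeriv j) hpar) z
    rw [iteratedDeriv_const_mul_field, iteratedDeriv_comp_const_add,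
      iteratedDeriv_comp_const_sub] at h1
    simpa using h1
  have key : ∀ z, f z * deriv f z = 0 ∨ f z = 0 := by
    intro y
    obtain ⟨z, rfl⟩ : ∃ z, y = z₀ + z := ⟨y - z₀, by ring⟩
    have a1 := hder 1 z
    have a2 := hder k z
    have a3 := congrFun hpar z
    have b1 := heq (z₀ + z)
    have b2 := heq (z₀ - z)
    have d1 := iteratedDeriv_one_pow hf (k + 1) (z₀ + z)
    change iteratedDeriv 1 F (z₀ + z) * (iteratedDeriv k F (z₀ + z) - F (z₀ + z)) =
      c * F (z₀ + z) * (F (z₀ + z) - 1) at b1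
    change iteratedDeriv 1 F (z₀ - z) * (iteratedDeriv k F (z₀ - z) - F (z₀ - z)) =
      c * F (z₀ - z) * (F (z₀ - z) - 1) at b2
    rcases Nat.even_or_odd k with hke | hko
    · right
      rw [hke.neg_one_pow, pow_succ, hke.neg_one_pow] at a2
      rw [pow_one, pow_succ, hke.neg_one_pow] at a1
      rw [pow_succ, hke.neg_one_pow] at a3
      have e1 : iteratedDeriv 1 F (z₀ - z) = iteratedDeriv 1 F (z₀ + z) := by
        linear_combination -a1
      have e2 : iteratedDeriv k F (z₀ - z) = -iteratedDeriv k F (z₀ + z) := by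
        linear_combination a2
      have e3 : F (z₀ - z) = -F (z₀ + z) := by linear_combination a3
      rw [e1, e2, e3] at b2
      have : 2 * c * F (z₀ + z) ^ 2 = 0 := by linear_combination - b1 - b2
      have h2 : F (z₀ + z) = 0 := by simpa [hc] using this
      exact eq_zero_of_pow_eq_zero h2
    · left
      rw [hko.neg_one_pow, pow_succ, hko.neg_one_pow] at a2
      rw [pow_one, pow_succ, hko.neg_one_pow] at a1
      rw [pow_succ, hko.neg_one_pow] at a3
      have e1 : iteratedDeriv 1 F (z₀ - z) = -iteratedDeriv 1 F (z₀ + z) := by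
        linear_combination -a1
      have e2 : iteratedDeriv k F (z₀ - z) = -iteratedDeriv k F (z₀ + z) := by
        linear_combination -a2
      have e3 : F (z₀ - z) = F (z₀ + z) := by linear_combination a3
      rw [e1, e2, e3] at b2
      have h2 : iteratedDeriv 1 F (z₀ + z) * F (z₀ + z) = 0 := by
        linear_combination (b2 - b1) / 2
      have hk1 : ((k + 1 : ℕ) : ℂ) ≠ 0 := Nat.cast_ne_zero.2 (by omega)
      rw [d1] at h2
      by_contra hne
      rw [mul_eq_zero, not_or] at hne
      exact mul_ne_zero (mul_ne_zero (mul_ne_zero hk1 (pow_ne_zero _ hne.1)) hne.2)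
        (pow_ne_zero (k + 1) hne.1) h2
  have hprod : (fun z => f z * deriv f z) = fun _ => 0 := by
    funext z
    rcases key z with h1 | h1
    · exact h1
    · rw [h1, zero_mul]
  have h1 := ((hf z₀).hasDerivAt.mul (hf.deriv z₀).hasDerivAt).deriv
  have h2 : deriv (fun z => f z * deriv f z) z₀ = 0 := by rw [hprod]; simp
  rw [h0, zero_mul, add_zero] at h1
  exact mul_ne_zero hs hs (h1.symm.trans h2)

/-- The auxiliary equation with `k = 1`, `n = 2` has no admissible solution with a zero. -/
theorem false_of_sq {f : ℂ → ℂ} (hf : Differentiable ℂ f) {c : ℂ} (hc : c ≠ 0)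
    (heq : ∀ z, 2 * deriv f z * (2 * deriv f z - f z) = c * (f z ^ 2 - 1)) {a : ℂ}
    (ha : ∀ z, deriv (deriv f) z = 1 / 4 * deriv f z + a * f z) {z₀ : ℂ} (h0 : f z₀ = 0)
    (hshare : ∀ z, 2 * f z * deriv f z = 1 → f z ^ 2 = 1) : False := by
  set g : ℂ → ℂ := fun z => f (z₀ + z) with hgdef
  have hg : Differentiable ℂ g := hf.comp (differentiable_id.const_add z₀)
  have hgd : deriv g = fun z => deriv f (z₀ + z) := by
    funext y
    exact ((hf (z₀ + y)).hasDerivAt.comp_const_add z₀ y).deriv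
  have hgd2 : deriv (deriv g) = fun z => deriv (deriv f) (z₀ + z) := by
    funext y
    rw [hgd]
    exact ((hf.deriv (z₀ + y)).hasDerivAt.comp_const_add z₀ y).deriv
  have hexp : ∀ s z : ℂ, HasDerivAt (fun z => Complex.exp (s * z)) (s * Complex.exp (s * z)) z := by
    intro s z
    have := ((hasDerivAt_id z).const_mul s).cexp
    simpa [mul_comm] using this
  set r : ℂ → ℂ := fun z => Complex.exp (-1 / 8 * z) * g z with hr
  have hr1 : deriv r = fun z => Complex.exp (-1 / 8 * z) * (deriv g z - 1 / 8 * g z) := by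
    funext y
    refine ((hexp _ y).mul (hg y).hasDerivAt).deriv.trans ?_
    ring
  have hr2 : ∀ z, deriv (deriv r) z = (a + 1 / 64) * r z := by
    intro y
    rw [hr1]
    refine ((hexp _ y).mul ((hg.deriv y).hasDerivAt.sub
      ((hg y).hasDerivAt.const_mul (1 / 8)))).deriv.trans ?_
    simp only [Pi.sub_apply, hr]
    rw [hgd2, hgd]
    simp only [ha, hgdef]
    ring
  have hrd : Differentiable ℂ r := fun y => ((hexp _ y).mul (hg y).hasDerivAt).differentiableAt
  have hrodd := apply_sub_eq_neg_of_deriv_deriv_eq hrd hr2 (z₀ := 0) (by simp [hr, hgdef, h0])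
  have hgodd : (fun z => g (0 - z)) = fun z => -(Complex.exp (-1 / 4 * z) * g z) := by
    funext y
    have h1 := hrodd y
    simp only [hr, zero_add] at h1
    have h2 : Complex.exp (-1 / 8 * (0 - y)) ≠ 0 := Complex.exp_ne_zero _
    refine mul_left_cancel₀ h2 ?_
    rw [h1, mul_neg, ← mul_assoc, ← Complex.exp_add]
    ring_nf
  have hgodd' : ∀ z, deriv g (0 - z) = Complex.exp (-1 / 4 * z) * (deriv g z - 1 / 4 * g z) := by
    intro y
    have h1 := ((hg (0 - y)).hasDerivAt.comp_const_sub 0 y).deriv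
    have h2 := ((hexp (-1 / 4) y).mul (hg y).hasDerivAt).neg.deriv
    have h3 := h1.symm.trans ((congrArg (fun u => deriv u y) hgodd).trans h2)
    linear_combination -h3
  have heqg : ∀ z, 2 * deriv g z * (2 * deriv g z - g z) = c * (g z ^ 2 - 1) := by
    intro y
    rw [hgd]
    exact heq _
  have hY : ∀ z, 2 * g z * deriv g z = 1 / 4 * g z ^ 2 +
      c * (1 - Complex.exp (1 / 4 * z) ^ 2) := by
    intro y
    have h1 := heqg y
    have h2 := heqg (0 - y)
    rw [hgodd', congrFun hgodd y] at h2
    have h3 : Complex.exp (1 / 4 * y) * Complex.exp (-1 / 4 * y) = 1 := by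
      rw [← Complex.exp_add, ← Complex.exp_zero]
      ring_nf
    generalize Complex.exp (1 / 4 * y) = x at *
    generalize Complex.exp (-1 / 4 * y) = t at *
    have h4 : x ^ 2 * t ^ 2 = 1 := by rw [← mul_pow, h3, one_pow]
    linear_combination -h1 + x ^ 2 * h2 -
      (4 * deriv g y ^ 2 - g y ^ 2 / 4 - c * g y ^ 2) * h4
  have hx : ∀ z, HasDerivAt (fun z : ℂ => Complex.exp (1 / 4 * z))
    (1 / 4 * Complex.exp (1 / 4 * z)) z := hexp _
  have hD : ∀ z, HasDerivAt (fun z => g z ^ 2 + 4 * c * (Complex.exp (1 / 4 * z) - 1) ^ 2)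
      (1 / 4 * (g z ^ 2 + 4 * c * (Complex.exp (1 / 4 * z) - 1) ^ 2)) z := by
    intro y
    refine (((hg y).hasDerivAt.pow 2).add
      ((((hx y).sub_const 1).pow 2).const_mul (4 * c))).congr_deriv ?_
    have := hY y
    norm_num
    linear_combination this
  have hsol : ∀ z, g z ^ 2 + 4 * c * (Complex.exp (1 / 4 * z) - 1) ^ 2 = 0 :=
    eq_zero_of_iteratedDeriv_eq_mul (z₀ := 0) (a := 1 / 4) (m := 1)
      (fun y => (hD y).differentiableAt) le_rfl
      (fun y => by rw [iteratedDeriv_one]; exact (hD y).deriv)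
      (fun i hi => by
        interval_cases i
        simp [hgdef, h0])
  set y : ℂ := 4 * Real.pi * Complex.I with hy
  have hx1 : Complex.exp (1 / 4 * y) = -1 := by
    rw [hy, ← Complex.exp_pi_mul_I]
    ring_nf
  have h1 := hsol y
  have h2 := hY y
  have h3 := heqg y
  rw [hx1] at h1 h2
  have h4 : g y ^ 2 = -16 * c := by linear_combination h1
  have h5 : 2 * g y * deriv g y = -4 * c := by linear_combination h2 + h4 / 4
  have h6 : c ^ 2 * (1 + 4 * c) = 0 := by
    have e : (2 * g y * deriv g y) ^ 2 - (2 * g y * deriv g y) * g y ^ 2 =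
      c * (g y ^ 2) ^ 2 - c * g y ^ 2 := by linear_combination g y ^ 2 * h3
    rw [h5, h4] at e
    linear_combination -e / 64
  have h7 : c = -1 / 4 := by
    have := (mul_eq_zero.1 h6).resolve_left (pow_ne_zero 2 hc)
    linear_combination this / 4
  have h8 := hshare (z₀ + y) (by
    rw [hgd] at h5
    rw [h7] at h5
    linear_combination h5)
  have h9 : f (z₀ + y) ^ 2 = 4 := by
    rw [h7] at h4
    linear_combination h4
  rw [h9] at h8
  norm_num at h8

/-- A nonconstant entire `f` such that `f ^ n` and `(f ^ n)⁽ᵏ⁾` share the value `1` is a solution of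
`(f ^ n)⁽ᵏ⁾ = f ^ n`. -/
theorem iteratedDeriv_pow_eq_of_share_one {f : ℂ → ℂ} (hf : Differentiable ℂ f)
    (hnc : ∃ z, deriv f z ≠ 0) {L : ℝ} (hL : 0 < L)
    (h : ∀ z, ‖deriv f z‖ ≤ L * (1 + ‖f z‖)) {k n : ℕ} (hk : 1 ≤ k) (hkn : k + 1 ≤ n)
    (hshare : ∀ z, f z ^ n = 1 ↔ iteratedDeriv k (fun w => f w ^ n) z = 1) (z : ℂ) :
    iteratedDeriv k (fun w => f w ^ n) z = f z ^ n := by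
  have hb : ∀ z, ‖f z‖ ≤ (1 + ‖f 0‖) * Real.exp (L * ‖z‖) := by
    intro z
    have := one_add_norm_le_exp_mul hf hL h 0 z
    rw [sub_zero] at this
    linarith
  have hb0 : 0 < 1 + ‖f 0‖ := by positivity
  have hn0 : (n : ℂ) ≠ 0 := Nat.cast_ne_zero.2 (by omega)
  have hmul : ∀ u : ℂ → ℂ, Differentiable ℂ u → (∀ z, deriv f z * u z = 0) → ∀ z, u z = 0 := by
    intro u hu hz
    have h1 := (Complex.analyticOnNhd_univ_iff_differentiable.2
      hf.deriv).eq_zero_or_eq_zero_of_mul_eq_zero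
      (Complex.analyticOnNhd_univ_iff_differentiable.2 hu) (fun z _ => hz z) isPreconnected_univ
    obtain ⟨x, hx⟩ := hnc
    exact fun z => (h1.resolve_left fun h2 => hx (h2 x trivial)) z trivial
  obtain ⟨x, hx⟩ : ∃ x, f x ^ n ≠ 1 := by
    by_contra! hcon
    obtain ⟨x, hx⟩ := hnc
    have h1 := iteratedDeriv_one_pow hf n x
    rw [show (fun w => f w ^ n) = fun _ => 1 from funext hcon, iteratedDeriv_one] at h1
    have hfx : f x ≠ 0 := by
      intro h0
      have := hcon x
      rw [h0, zero_pow (by omega)] at this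
      exact zero_ne_one this
    simp [hn0, hfx, hx] at h1
  obtain ⟨φ, hφ, hφE⟩ := exists_auxiliary_quotient hf hkn (fun z => (hshare z).1) hx
  obtain ⟨C, hC⟩ := exists_norm_auxiliary_quotient_le hf hnc hL h hk hkn
    (fun z => (hshare z).1) hφ hφE
  have hconst : ∀ z, φ z = φ 0 := fun z => hφ.apply_eq_apply_of_bounded
    (isBounded_iff_forall_norm_le.2 ⟨_, by rintro _ ⟨w, rfl⟩; exact hC w⟩) z 0
  generalize φ 0 = c at hconst
  simp only [hconst] at hφE
  have hode := deriv_pow_mul_sub_eq hf hkn hφE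
  rcases eq_or_ne c 0 with rfl | hc
  · have hd : Differentiable ℂ fun z => f z ^ (n - k - 1) *
        (powDerivCofactor f n k z - f z ^ k) * f z :=
      ((hf.pow _).mul ((differentiable_powDerivCofactor hf n k).sub (hf.pow k))).mul hf
    have h1 := hmul _ hd (fun z => by
      refine mul_left_cancel₀ hn0 ?_
      linear_combination f z * hφE z) z
    rw [iteratedDeriv_pow_eq_powDerivCofactor hf (by omega)]
    obtain ⟨m, rfl⟩ := Nat.exists_eq_add_of_le hkn
    rw [show k + 1 + m - k - 1 = m by omega] at h1
    rw [show k + 1 + m - k = m + 1 by omega]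
    linear_combination h1
  exfalso
  obtain ⟨z₀, h0⟩ := exists_eq_zero_of_auxiliary_eq hf hb0 hL.le hb hnc (by omega) hc hode
  obtain rfl : n = k + 1 := by
    by_contra hne
    have h1 := hφE z₀
    rw [h0, zero_pow (by omega), zero_pow (by omega), zero_pow (by omega)] at h1
    exact hc (by linear_combination h1)
  have heq : ∀ z, ((k + 1 : ℕ) : ℂ) * deriv f z *
      (powDerivCofactor f (k + 1) k z - f z ^ k) = c * (f z ^ (k + 1) - 1) := by
    intro z
    have h1 := hφE z
    rwa [show k + 1 - k - 1 = 0 by omega, pow_zero, mul_one] at h1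
  have hs : ∀ z, f z = 0 → deriv f z ≠ 0 := by
    intro z hz hd
    have h1 := heq z
    rw [hz, hd, zero_pow k.succ_ne_zero] at h1
    exact hc (by linear_combination h1)
  obtain ⟨ε, hε, hlarge⟩ := exists_le_norm_of_auxiliary_eq hf hL h (by omega) hc heq
  obtain ⟨a, ha⟩ := exists_deriv_deriv_eq hf hL h hs
    (fun z hz => deriv_deriv_eq_of_auxiliary_eq hf hk heq hz (hs z hz)) hε hlarge
  split_ifs at ha with hk1
  · subst hk1
    refine false_of_sq hf hc (fun z => ?_) ha h0 fun z hz => ?_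
    · have h1 := heq z
      simpa [powDerivCofactor] using h1
    · refine (hshare z).2 ?_
      rw [iteratedDeriv_one_pow hf]
      simpa using hz
  · exact false_of_odd hf hc hode h0 (hs z₀ h0) fun z =>
      apply_sub_eq_neg_of_deriv_deriv_eq hf (fun z => by rw [ha, zero_mul, zero_add]) h0 z

end

/-- Majumder et al. (paper's Theorem 2.G): if `f` is transcendental entire,
`n ≥ k + 1` and `f^n`, `(f^n)^(k)` share `1` IM, then `f^n ≡ (f^n)^(k)`,
i.e. `f(z) = c e^{(λ/n) z}` with `λ^k = 1`. -/
theorem majumder_IM_transcendental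
    (f : ℂ → ℂ) (hf : Differentiable ℂ f)
    (htr : ¬∃ p : Polynomial ℂ, ∀ z, f z = p.eval z)
    (k n : ℕ) (hk : 1 ≤ k) (hn : k + 1 ≤ n)
    (hshare : ∀ z, f z ^ n = 1 ↔ iteratedDeriv k (fun w => f w ^ n) z = 1) :
    (∀ z, iteratedDeriv k (fun w => f w ^ n) z = f z ^ n) ∧
    ∃ c l : ℂ, c ≠ 0 ∧ l ≠ 0 ∧ l ^ k = 1 ∧
      ∀ z, f z = c * Complex.exp (l / (n : ℂ) * z) := by
  have hnc : ∃ z, deriv f z ≠ 0 := by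
    by_contra! h
    exact htr ⟨Polynomial.C (f 0), fun z => by
      rw [Polynomial.eval_C, is_const_of_deriv_eq_zero hf h z 0]⟩
  obtain ⟨M, hM⟩ := exists_norm_deriv_le_of_norm_le_one hf hk hn fun z => (hshare z).2
  obtain ⟨L, hL, hfL⟩ := exists_norm_deriv_le_mul hf hnc hM
  have hF := iteratedDeriv_pow_eq_of_share_one hf hnc hL hfL hk hn hshare
  refine ⟨hF, exists_eq_mul_exp_of_iteratedDeriv_pow_eq hf (K := 1 + ‖f 0‖) (by positivity) hL.le
    (fun z => ?_) hnc hk hn hF⟩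
  have := one_add_norm_le_exp_mul hf hL hfL 0 z
  rw [sub_zero] at this
  linarith
end

section
/- Let m ≥ 1 and define f : ℂ^m → ℂ by f(z) = 2·exp((z₁+⋯+z_m)/2) − 1, and let u ∈ ℂ^m be a unit vector with u₁+⋯+u_m = 1 (for instance u = e₁). Then ∂_u f(z) = exp((z₁+⋯+z_m)/2) for all z, one has ∂_u f − 1 = (1/2)·(f − 1) so that f and ∂_u f share the value 1 CM, and yet there is no c ∈ ℂ such that f = c·∂_u f. Hence the hypothesis n ≥ k + 1 in the paper's Theorem 2.1 cannot be weakened to n = k (here n = k = 1). (Paper's Example 2.1.) -/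
/-- The directional derivative of `f : ℂ^m → ℂ` along the direction `u`. -/
noncomputable def dirDeriv {m : ℕ} (u : Fin m → ℂ) (f : (Fin m → ℂ) → ℂ) :
    (Fin m → ℂ) → ℂ :=
  fun z => fderiv ℂ f z u

/-- The function of the paper's Example 2.1: `f(z) = 2 exp((z₁+⋯+z_m)/2) − 1`. -/
noncomputable def exampleOneFun (m : ℕ) : (Fin m → ℂ) → ℂ :=
  fun z => 2 * Complex.exp ((∑ j, z j) / 2) - 1

theorem dirDeriv_exampleOneFun {m : ℕ} (u z : Fin m → ℂ) :
    dirDeriv u (exampleOneFun m) z = (∑ j, u j) * Complex.exp ((∑ j, z j) / 2) := by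
  have hsum : HasFDerivAt (fun w : Fin m → ℂ => ∑ j, w j)
      (∑ j, ContinuousLinearMap.proj (R := ℂ) (φ := fun _ : Fin m => ℂ) j) z :=
    HasFDerivAt.fun_sum fun j _ => hasFDerivAt_apply j z
  have h := ((hsum.mul_const (2⁻¹ : ℂ)).cexp.const_mul (2 : ℂ)).sub_const 1
  simp only [← div_eq_mul_inv] at h
  unfold dirDeriv exampleOneFun
  rw [h.fderiv]
  simp
  ring

/-- Paper's Example 2.1: the hypothesis `n ≥ k + 1` in Theorem 2.1 is necessary
(here `n = k = 1`): `f` and `∂_u f` share `1` CM but `f ≢ c ∂_u f`. -/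
theorem example_necessity_n_ge_k_add_one
    (m : ℕ) (hm : 1 ≤ m) (u : Fin m → ℂ)
    (hu : ∑ j, Complex.normSq (u j) = 1) (husum : ∑ j, u j = 1) :
    (∀ z, dirDeriv u (exampleOneFun m) z = Complex.exp ((∑ j, z j) / 2)) ∧
    (∀ z, dirDeriv u (exampleOneFun m) z - 1 = (1 / 2) * (exampleOneFun m z - 1)) ∧
    ¬∃ c : ℂ, ∀ z, exampleOneFun m z = c * dirDeriv u (exampleOneFun m) z := by
  have hderiv : ∀ z, dirDeriv u (exampleOneFun m) z = Complex.exp ((∑ j, z j) / 2) := by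
    intro z
    rw [dirDeriv_exampleOneFun, husum, one_mul]
  refine ⟨hderiv, fun z => ?_, ?_⟩
  · rw [hderiv, exampleOneFun]
    ring
  · rintro ⟨c, hc⟩
    have h0 := hc 0
    have h1 := hc fun j => 2 * (Real.pi * Complex.I) * u j
    rw [hderiv, exampleOneFun] at h0 h1
    rw [← Finset.mul_sum, husum, mul_one, mul_div_cancel_left₀ _ two_ne_zero,
      Complex.exp_pi_mul_I] at h1
    simp only [Pi.zero_apply, Finset.sum_const_zero, zero_div, Complex.exp_zero] at h0
    have h : (2 : ℂ) = 0 := by linear_combination -h0 - h1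
    exact two_ne_zero h
end

section
/- Let m ≥ 1 and define f : ℂ^m → ℂ by f(z) = exp(√2·(z₁+⋯+z_m)) + 1/2, and let u = e₁ = (1,0,…,0). Then ∂_u² f = 2·exp(√2·(z₁+⋯+z_m)) = 2f − 1, so ∂_u² f − 1 = 2·(f − 1) and hence f and ∂_u² f share the value 1 CM; yet there is no c ∈ ℂ such that f = c·∂_u f. Hence the conclusion of the paper's Theorem 2.1 fails for n = 1, k = 2, showing the necessity of the hypothesis n ≥ k + 1. (Paper's Example 2.3.) -/
/-- The function of the paper's Example 2.3: `f(z) = exp(√2 (z₁+⋯+z_m)) + 1/2`. -/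
noncomputable def exampleThreeFun (m : ℕ) : (Fin m → ℂ) → ℂ :=
  fun z => Complex.exp ((Real.sqrt 2 : ℂ) * ∑ j, z j) + 1 / 2

/-- Directional derivative of an affine function of `exp (a (z₁ + ⋯ + z_m))`. -/
theorem dirDeriv_mul_exp_mul_sum_add {m : ℕ} (u : Fin m → ℂ) (a b c : ℂ) :
    dirDeriv u (fun z => b * Complex.exp (a * ∑ j, z j) + c) =
      fun z => b * (a * ∑ j, u j) * Complex.exp (a * ∑ j, z j) := by
  funext z
  have hsum : HasFDerivAt (fun w : Fin m → ℂ => ∑ j, w j)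
      (∑ j, ContinuousLinearMap.proj (R := ℂ) (φ := fun _ : Fin m => ℂ) j) z :=
    HasFDerivAt.fun_sum fun j _ => hasFDerivAt_apply j z
  have h := (((hsum.const_mul a).cexp.const_mul b).add_const c).fderiv
  simp only [dirDeriv, h, smul_apply, sum_apply,
    ContinuousLinearMap.proj_apply, smul_eq_mul]
  ring

/-- Paper's Example 2.3: for `n = 1`, `k = 2`, `u = e₁`, one has
`∂_u² f = 2 exp(√2 (z₁+⋯+z_m)) = 2f − 1`, so `f` and `∂_u² f` share `1` CM,
yet `f ≢ c ∂_u f`; hence Theorem 2.1 fails when `n < k + 1`. -/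
theorem example_necessity_k_two_n_one
    (m : ℕ) (hm : 0 < m) :
    (∀ z, (dirDeriv (Pi.single (⟨0, hm⟩ : Fin m) (1 : ℂ)))^[2] (exampleThreeFun m) z
        = 2 * Complex.exp ((Real.sqrt 2 : ℂ) * ∑ j, z j)) ∧
    (∀ z, (dirDeriv (Pi.single (⟨0, hm⟩ : Fin m) (1 : ℂ)))^[2] (exampleThreeFun m) z
        = 2 * exampleThreeFun m z - 1) ∧
    (∀ z, (dirDeriv (Pi.single (⟨0, hm⟩ : Fin m) (1 : ℂ)))^[2] (exampleThreeFun m) z - 1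
        = 2 * (exampleThreeFun m z - 1)) ∧
    ¬∃ c : ℂ, ∀ z, exampleThreeFun m z
        = c * dirDeriv (Pi.single (⟨0, hm⟩ : Fin m) (1 : ℂ)) (exampleThreeFun m) z := by
  have hs : ((√2 : ℝ) : ℂ) * ((√2 : ℝ) : ℂ) = 2 := by
    rw [← Complex.ofReal_mul, Real.mul_self_sqrt zero_le_two, Complex.ofReal_ofNat]
  have h1 : dirDeriv (Pi.single (⟨0, hm⟩ : Fin m) (1 : ℂ)) (exampleThreeFun m) =
      fun z => (√2 : ℝ) * Complex.exp ((√2 : ℝ) * ∑ j, z j) := by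
    simpa [funext_iff, show exampleThreeFun m = fun z =>
      Complex.exp ((√2 : ℝ) * ∑ j, z j) + 1 / 2 from rfl] using
      dirDeriv_mul_exp_mul_sum_add (Pi.single (⟨0, hm⟩ : Fin m) (1 : ℂ)) (√2 : ℝ) 1 (1 / 2)
  have h2 : ∀ z, (dirDeriv (Pi.single (⟨0, hm⟩ : Fin m) (1 : ℂ)))^[2] (exampleThreeFun m) z =
      2 * Complex.exp ((√2 : ℝ) * ∑ j, z j) := by
    intro z
    have h := dirDeriv_mul_exp_mul_sum_add
      (Pi.single (⟨0, hm⟩ : Fin m) (1 : ℂ)) (√2 : ℝ) (√2 : ℝ) 0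
    simp only [add_zero, Finset.sum_pi_single', Finset.mem_univ, if_true, mul_one, hs] at h
    rw [Function.iterate_succ_apply, Function.iterate_one, h1, h]
  refine ⟨h2, fun z => ?_, fun z => ?_, ?_⟩
  · rw [h2, exampleThreeFun]
    ring
  · rw [h2, exampleThreeFun]
    ring
  · rintro ⟨c, hc⟩
    have hs0 : ((√2 : ℝ) : ℂ) ≠ 0 := left_ne_zero_of_mul (hs ▸ two_ne_zero)
    have hzero := hc 0
    have hneg := hc (Pi.single ⟨0, hm⟩ (Real.pi * Complex.I / (√2 : ℝ)))
    simp only [h1, exampleThreeFun, Pi.zero_apply, Finset.sum_const_zero, mul_zero,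
      Complex.exp_zero] at hzero
    simp only [h1, exampleThreeFun, Finset.sum_pi_single', Finset.mem_univ, if_true,
      mul_div_cancel₀ _ hs0, Complex.exp_pi_mul_I] at hneg
    have : (1 : ℂ) = 0 := by linear_combination hzero + hneg
    exact one_ne_zero this
end

section
/- Let m ≥ 1 and define f : ℂ^m → ℂ by f(z) = √(5/2)·sin z₁, and let u = e₁ = (1,0,…,0). Then ∂_u²(f²) = 5 − 4f², so ∂_u²(f²) − 1 = −4·(f² − 1) and hence f² and ∂_u²(f²) share the value 1 CM; yet there is no c ∈ ℂ such that f = c·∂_u f. Hence the conclusion of the paper's Theorem 2.1 fails for n = k = 2, again showing the necessity of the hypothesis n ≥ k + 1. (Paper's Example 2.4.) -/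
/-- The function of the paper's Example 2.4: `f(z) = √(5/2) sin z₁`. -/
noncomputable def exampleFourFun (m : ℕ) (hm : 0 < m) : (Fin m → ℂ) → ℂ :=
  fun z => (Real.sqrt (5 / 2) : ℂ) * Complex.sin (z ⟨0, hm⟩)

theorem dirDeriv_single_comp_apply {m : ℕ} (i : Fin m) {g g' : ℂ → ℂ}
    (hg : ∀ x, HasDerivAt g (g' x) x) :
    dirDeriv (Pi.single i (1 : ℂ)) (fun w => g (w i)) = fun w => g' (w i) := by
  funext z
  have h : HasFDerivAt (fun w : Fin m → ℂ => w i)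
      (ContinuousLinearMap.proj (R := ℂ) (φ := fun _ : Fin m => ℂ) i) z :=
    (ContinuousLinearMap.proj (R := ℂ) (φ := fun _ : Fin m => ℂ) i).hasFDerivAt
  have hc : HasFDerivAt (fun w : Fin m → ℂ => g (w i)) _ z :=
    (hg (z i)).comp_hasFDerivAt z h
  simp [dirDeriv, hc.fderiv]

theorem ofReal_sqrt_five_halves_sq : (Real.sqrt (5 / 2) : ℂ) ^ 2 = 5 / 2 := by
  rw [← Complex.ofReal_pow, Real.sq_sqrt (by norm_num)]
  push_cast
  rfl

theorem dirDeriv_exampleFourFun (m : ℕ) (hm : 0 < m) :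
    dirDeriv (Pi.single (⟨0, hm⟩ : Fin m) (1 : ℂ)) (exampleFourFun m hm) =
      fun w => (Real.sqrt (5 / 2) : ℂ) * Complex.cos (w ⟨0, hm⟩) :=
  dirDeriv_single_comp_apply (⟨0, hm⟩ : Fin m)
    (fun x => (Complex.hasDerivAt_sin x).const_mul _)

theorem dirDeriv_iterate_two_exampleFourFun_sq (m : ℕ) (hm : 0 < m) (z : Fin m → ℂ) :
    (dirDeriv (Pi.single (⟨0, hm⟩ : Fin m) (1 : ℂ)))^[2]
      (fun w => exampleFourFun m hm w ^ 2) z = 5 - 4 * exampleFourFun m hm z ^ 2 := by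
  have hsq : (fun w => exampleFourFun m hm w ^ 2) =
      fun w => 5 / 2 * Complex.sin (w ⟨0, hm⟩) ^ 2 := by
    funext w
    rw [exampleFourFun, mul_pow, ofReal_sqrt_five_halves_sq]
  have h₁ : ∀ x, HasDerivAt (fun x => 5 / 2 * Complex.sin x ^ 2)
      (5 * (Complex.sin x * Complex.cos x)) x := fun x => by
    refine (((Complex.hasDerivAt_sin x).pow 2).const_mul (5 / 2)).congr_deriv ?_
    push_cast
    ring
  have h₂ : ∀ x, HasDerivAt (fun x => 5 * (Complex.sin x * Complex.cos x))
      (5 - 10 * Complex.sin x ^ 2) x := fun x => by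
    refine (((Complex.hasDerivAt_sin x).mul (Complex.hasDerivAt_cos x)).const_mul
      5).congr_deriv ?_
    linear_combination 5 * Complex.sin_sq_add_cos_sq x
  rw [congrFun hsq z, hsq, Function.iterate_succ_apply, Function.iterate_one,
    dirDeriv_single_comp_apply (⟨0, hm⟩ : Fin m) h₁,
    dirDeriv_single_comp_apply (⟨0, hm⟩ : Fin m) h₂]
  ring

/-- Paper's Example 2.4: for `n = k = 2`, `u = e₁`, one has
`∂_u²(f²) = 5 − 4 f²`, so `∂_u²(f²) − 1 = −4 (f² − 1)` and hence `f²` and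
`∂_u²(f²)` share `1` CM, yet `f ≢ c ∂_u f`; hence Theorem 2.1 fails when
`n < k + 1`. -/
theorem example_necessity_k_two_n_two
    (m : ℕ) (hm : 0 < m) :
    (∀ z, (dirDeriv (Pi.single (⟨0, hm⟩ : Fin m) (1 : ℂ)))^[2]
        (fun w => exampleFourFun m hm w ^ 2) z = 5 - 4 * exampleFourFun m hm z ^ 2) ∧
    (∀ z, (dirDeriv (Pi.single (⟨0, hm⟩ : Fin m) (1 : ℂ)))^[2]
        (fun w => exampleFourFun m hm w ^ 2) z - 1
        = -4 * (exampleFourFun m hm z ^ 2 - 1)) ∧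
    ¬∃ c : ℂ, ∀ z, exampleFourFun m hm z
        = c * dirDeriv (Pi.single (⟨0, hm⟩ : Fin m) (1 : ℂ)) (exampleFourFun m hm) z := by
  refine ⟨dirDeriv_iterate_two_exampleFourFun_sq m hm, fun z => ?_, ?_⟩
  · rw [dirDeriv_iterate_two_exampleFourFun_sq]
    ring
  · rintro ⟨c, hc⟩
    rw [dirDeriv_exampleFourFun] at hc
    have h := hc fun _ => (Real.pi / 2 : ℂ)
    simp [exampleFourFun] at h
end
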